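/- arXiv:0804.4311 — 3 statements merged into one kernel-verified Lean document; each statement's English description precedes it below -/
import Mathlib

section
/- Let X̃_t be the decoherent Hadamard walk starting at |0,1⟩ with 0 < p ≤ 1 and q = 1 − p, let μ_t = E(X̃_t), and set v = (p + 2√(1+q²) − 2)/p. Then for every fixed real k, e^{−iμ_t k/√t}·P̃̂(k/√t, t) = exp(−(v/2)k²) + O(t^{−1/2}) as t → ∞ (i.e., for each k there are constants C > 0 and T such that the difference is bounded by C/√t for all t ≥ T); consequently (X̃_t − μ_t)/√t converges in distribution to the centered Gaussian law N(0, v). -/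
noncomputable section

open Complex Filter

/-- Amplitude functions on the position × coin space `ℤ × {1,2}`
(coin `0` = "right", coin `1` = "left"). -/
abbrev QState := ℤ × Fin 2 → ℂ

/-- One step of the Hadamard walk: `(hadamardStep ψ) (x,n) = ⟨x,n|U ψ⟩`, where `U = S ∘ C`
with `S` the chirality-conditioned shift and `C` the Hadamard coin. -/
def hadamardStep (ψ : QState) : QState := fun v =>
  if v.2 = 0 then (ψ (v.1 - 1, 0) + ψ (v.1 - 1, 1)) / (Real.sqrt 2 : ℂ)
  else (ψ (v.1 + 1, 0) - ψ (v.1 + 1, 1)) / (Real.sqrt 2 : ℂ)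

/-- The basis state `|x,n⟩`. -/
def ket (x : ℤ) (n : Fin 2) : QState := fun v => if v = (x, n) then 1 else 0

/-- Pure Hadamard-walk probabilities `W_{m,n}(x,t) = |⟨x,n|U^t|0,m⟩|²`. -/
def W (m n : Fin 2) (x : ℤ) (t : ℕ) : ℝ := ‖(hadamardStep^[t] (ket 0 m)) (x, n)‖ ^ 2

/-- Measurement operators, indexed by `𝔸 = {c} ∪ ℤ×{1,2}`:
`none` is the coherent projection `A_c = √(1-p)·I`, and `some (x,n)` is the
decoherence projection `A_{x,n} = √p |x,n⟩⟨x,n|`. -/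
def measOp (p : ℝ) : Option (ℤ × Fin 2) → QState → QState
  | none => fun ψ v => (Real.sqrt (1 - p) : ℂ) * ψ v
  | some w => fun ψ v => if v = w then (Real.sqrt p : ℂ) * ψ w else 0

/-- The amplitude `(A_{j_t}U)⋯(A_{j_1}U)|0,m⟩` along the path `j`. -/
def pathAmp (p : ℝ) (m : Fin 2) : (t : ℕ) → (Fin t → Option (ℤ × Fin 2)) → QState
  | 0, _ => ket 0 m
  | t + 1, j => measOp p (j (Fin.last t)) (hadamardStep (pathAmp p m t fun i => j i.castSucc))

/-- Decoherent Hadamard-walk probabilities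
`P_{m,n}(x,t) = Σ_{j∈𝔸^t} |⟨x,n|(A_{j_t}U)⋯(A_{j_1}U)|0,m⟩|²`. -/
def Pdec (p : ℝ) (m n : Fin 2) (x : ℤ) (t : ℕ) : ℝ :=
  ∑' j : Fin t → Option (ℤ × Fin 2), ‖pathAmp p m t j (x, n)‖ ^ 2

/-- `Ŵ_{m,n}(k,t) = Σ_x W_{m,n}(x,t) e^{ikx}`. -/
def What (m n : Fin 2) (k : ℝ) (t : ℕ) : ℂ :=
  ∑' x : ℤ, (W m n x t : ℂ) * Complex.exp (Complex.I * k * x)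

/-- `P̂_{m,n}(k,z) = Σ_{t≥0} Σ_x P_{m,n}(x,t) e^{ikx} z^t`. -/
def Phat (p : ℝ) (m n : Fin 2) (k : ℝ) (z : ℂ) : ℂ :=
  ∑' t : ℕ, (∑' x : ℤ, (Pdec p m n x t : ℂ) * Complex.exp (Complex.I * k * x)) * z ^ t

/-- `Q̂_{m,n}(k,z) = (p/q) Σ_{t≥1} Ŵ_{m,n}(k,t) (qz)^t = p Σ_{t≥1} Ŵ_{m,n}(k,t) q^{t-1} z^t`
with `q = 1-p`. -/
def Qhat (p : ℝ) (m n : Fin 2) (k : ℝ) (z : ℂ) : ℂ :=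
  (p : ℂ) * ∑' t : ℕ, What m n k (t + 1) * ((1 - p : ℝ) : ℂ) ^ t * z ^ (t + 1)

/-- The matrix `P(k,z) = (P̂_{m,n}(k,z))`. -/
def Pmat (p k : ℝ) (z : ℂ) : Matrix (Fin 2) (Fin 2) ℂ := Matrix.of fun m n => Phat p m n k z

/-- The matrix `Q(k,z) = (Q̂_{m,n}(k,z))`. -/
def Qmat (p k : ℝ) (z : ℂ) : Matrix (Fin 2) (Fin 2) ℂ := Matrix.of fun m n => Qhat p m n k z

/-- Maximum row-sum norm of a 2×2 complex matrix. -/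
def rowSumNorm (A : Matrix (Fin 2) (Fin 2) ℂ) : ℝ :=
  max (‖A 0 0‖ + ‖A 0 1‖) (‖A 1 0‖ + ‖A 1 1‖)

/-- Distribution of the symmetric decoherent Hadamard walk:
`P(X_t = x) = (1/2) Σ_{m,n} P_{m,n}(x,t)`. -/
def PsymProb (p : ℝ) (x : ℤ) (t : ℕ) : ℝ := (1/2) * ∑ m : Fin 2, ∑ n : Fin 2, Pdec p m n x t

/-- Mean position of the symmetric decoherent walk. -/
def symMean (p : ℝ) (t : ℕ) : ℝ := ∑' x : ℤ, (x : ℝ) * PsymProb p x t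

/-- Variance of the symmetric decoherent walk. -/
def symVar (p : ℝ) (t : ℕ) : ℝ :=
  (∑' x : ℤ, (x : ℝ) ^ 2 * PsymProb p x t) - (∑' x : ℤ, (x : ℝ) * PsymProb p x t) ^ 2

/-- The symmetric generating function `P̂(k,z) = (1/2) Σ_{m,n} P̂_{m,n}(k,z)`. -/
def PhatSym (p k : ℝ) (z : ℂ) : ℂ := (1/2) * ∑ m : Fin 2, ∑ n : Fin 2, Phat p m n k z

/-- Characteristic function `P̂(k,t)` of the symmetric decoherent walk. -/
def charSym (p k : ℝ) (t : ℕ) : ℂ :=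
  ∑' x : ℤ, (PsymProb p x t : ℂ) * Complex.exp (Complex.I * k * x)

/-- Distribution of the decoherent walk started at `|0,1⟩`: `P(X̃_t = x) = Σ_n P_{1,n}(x,t)`. -/
def Ptilde (p : ℝ) (x : ℤ) (t : ℕ) : ℝ := ∑ n : Fin 2, Pdec p 0 n x t

/-- Mean position of the decoherent walk started at `|0,1⟩`. -/
def tildeMean (p : ℝ) (t : ℕ) : ℝ := ∑' x : ℤ, (x : ℝ) * Ptilde p x t

/-- Variance of the decoherent walk started at `|0,1⟩`. -/
def tildeVar (p : ℝ) (t : ℕ) : ℝ :=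
  (∑' x : ℤ, (x : ℝ) ^ 2 * Ptilde p x t) - (∑' x : ℤ, (x : ℝ) * Ptilde p x t) ^ 2

/-- Characteristic function of the decoherent walk started at `|0,1⟩`. -/
def charTilde (p k : ℝ) (t : ℕ) : ℂ :=
  ∑' x : ℤ, (Ptilde p x t : ℂ) * Complex.exp (Complex.I * k * x)

/-- The symmetric initial state `φ₀ = (|0,1⟩ + i|0,2⟩)/√2`. -/
def phi0 : QState := fun v =>
  if v = ((0 : ℤ), (0 : Fin 2)) then (1 / Real.sqrt 2 : ℂ)
  else if v = ((0 : ℤ), (1 : Fin 2)) then Complex.I / Real.sqrt 2 else 0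

/-- Distribution of the pure symmetric Hadamard walk: `P(Q_t = x) = Σ_n |⟨x,n|U^t|φ₀⟩|²`. -/
def Ppure (x : ℤ) (t : ℕ) : ℝ := ∑ n : Fin 2, ‖(hadamardStep^[t] phi0) (x, n)‖ ^ 2

/-- Variance of the pure symmetric Hadamard walk. -/
def pureVar (t : ℕ) : ℝ :=
  (∑' x : ℤ, (x : ℝ) ^ 2 * Ppure x t) - (∑' x : ℤ, (x : ℝ) * Ppure x t) ^ 2

/-- `E(k,z) = √((q²z² − (1+cos k)qz + 1)(q²z² + (1+cos k)qz + 1))`, principal branch. -/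
def Efun (q k : ℝ) (z : ℂ) : ℂ :=
  (((q : ℂ) ^ 2 * z ^ 2 - (1 + (Real.cos k : ℂ)) * (q : ℂ) * z + 1) *
    ((q : ℂ) ^ 2 * z ^ 2 + (1 + (Real.cos k : ℂ)) * (q : ℂ) * z + 1)) ^ ((1 : ℂ) / 2)

/-- The sign attached to the coin state by the Hadamard coin. -/
def coinSign (m : Fin 2) : ℂ := if m = 0 then 1 else -1

/-- The effect of the averaged measurement on an observable: off-diagonal entries are damped
by `q`. -/
def damp (q : ℂ) (O : ℤ × Fin 2 → ℤ × Fin 2 → ℂ) (u v : ℤ × Fin 2) : ℂ :=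
  if u = v then O u v else q * O u v

/-- One step of the decoherent Hadamard walk in the Heisenberg picture, acting on the matrix
entries of observables. -/
def heis (q : ℂ) :
    (ℤ × Fin 2 → ℤ × Fin 2 → ℂ) →ₗ[ℂ] (ℤ × Fin 2 → ℤ × Fin 2 → ℂ) where
  toFun O u v := (1 / 2) *
    (damp q O (u.1 + 1, 0) (v.1 + 1, 0)
      + coinSign v.2 * damp q O (u.1 + 1, 0) (v.1 - 1, 1)
      + coinSign u.2 * damp q O (u.1 - 1, 1) (v.1 + 1, 0)
      + coinSign u.2 * coinSign v.2 * damp q O (u.1 - 1, 1) (v.1 - 1, 1))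
  map_add' O O' := by
    ext u v
    simp only [damp, Pi.add_apply]
    split_ifs <;> ring
  map_smul' c O := by
    ext u v
    simp only [damp, Pi.smul_apply, smul_eq_mul, RingHom.id_apply]
    split_ifs <;> ring

lemma heis_apply (q : ℂ) (O : ℤ × Fin 2 → ℤ × Fin 2 → ℂ) (u v : ℤ × Fin 2) :
    heis q O u v = (1 / 2) *
    (damp q O (u.1 + 1, 0) (v.1 + 1, 0)
      + coinSign v.2 * damp q O (u.1 + 1, 0) (v.1 - 1, 1)
      + coinSign u.2 * damp q O (u.1 - 1, 1) (v.1 + 1, 0)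
      + coinSign u.2 * coinSign v.2 * damp q O (u.1 - 1, 1) (v.1 - 1, 1)) := rfl

/-- The matrix unit with entry `1` at `(u, v)`. -/
def matUnit (u v a b : ℤ × Fin 2) : ℂ := if a = u ∧ b = v then 1 else 0

/-- The position from which the walker reaches `u` in one step. -/
def prevPos (u : ℤ × Fin 2) : ℤ := if u.2 = 0 then u.1 - 1 else u.1 + 1

lemma hadamardStep_apply (ψ : QState) (u : ℤ × Fin 2) :
    hadamardStep ψ u =
      (ψ (prevPos u, 0) + coinSign u.2 * ψ (prevPos u, 1)) / (Real.sqrt 2 : ℂ) := by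
  obtain ⟨x, n⟩ := u
  fin_cases n <;> simp [hadamardStep, prevPos, coinSign, sub_eq_add_neg]

lemma damp_matUnit (q : ℂ) (u v : ℤ × Fin 2) :
    damp q (matUnit u v) = (if u = v then 1 else q) • matUnit u v := by
  ext a b
  simp only [damp, matUnit, Pi.smul_apply, smul_eq_mul]
  by_cases h : a = u ∧ b = v
  · obtain ⟨rfl, rfl⟩ := h
    simp
  · simp [h]

lemma heis_matUnit (q : ℂ) (u v : ℤ × Fin 2) :
    heis q (matUnit u v) = ((if u = v then 1 else q) / 2) •
      (matUnit (prevPos u, 0) (prevPos v, 0)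
        + coinSign v.2 • matUnit (prevPos u, 0) (prevPos v, 1)
        + coinSign u.2 • matUnit (prevPos u, 1) (prevPos v, 0)
        + (coinSign u.2 * coinSign v.2) • matUnit (prevPos u, 1) (prevPos v, 1)) := by
  ext a b
  rw [heis_apply, damp_matUnit]
  generalize (if u = v then (1 : ℂ) else q) = c
  obtain ⟨x, n⟩ := u
  obtain ⟨y, n'⟩ := v
  obtain ⟨x', m⟩ := a
  obtain ⟨y', m'⟩ := b
  fin_cases n <;> fin_cases n' <;> fin_cases m <;> fin_cases m' <;>
    simp [matUnit, prevPos, coinSign, eq_sub_iff_add_eq, sub_eq_iff_eq_add, div_eq_inv_mul,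
      mul_comm] <;>
    split_ifs <;> simp

/-- Correlations of path amplitudes, summed over all paths, in the Heisenberg picture. -/
lemma hasSum_pathAmp (p : ℝ) (hp0 : 0 ≤ p) (hp1 : p ≤ 1) (m : Fin 2) (t : ℕ)
    (u v : ℤ × Fin 2) :
    HasSum (fun j : Fin t → Option (ℤ × Fin 2) =>
        pathAmp p m t j u * (starRingEnd ℂ) (pathAmp p m t j v))
      ((heis ((1 - p : ℝ) : ℂ) ^ t) (matUnit u v) (0, m) (0, m)) := by
  induction t generalizing u v with
  | zero =>
    convert! hasSum_unique (fun j : Fin 0 → Option (ℤ × Fin 2) =>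
      pathAmp p m 0 j u * (starRingEnd ℂ) (pathAmp p m 0 j v)) using 1
    simp only [pathAmp, ket, matUnit, pow_zero, Module.End.one_apply]
    by_cases h : u = (0, m) <;> by_cases h' : v = (0, m) <;> simp [h, h', eq_comm]
  | succ t ih =>
    set q : ℂ := ((1 - p : ℝ) : ℂ) with hq
    set S : ℂ := (1 / 2) * (
      (heis q ^ t) (matUnit (prevPos u, 0) (prevPos v, 0)) (0, m) (0, m)
        + coinSign v.2 * (heis q ^ t) (matUnit (prevPos u, 0) (prevPos v, 1)) (0, m) (0, m)
        + coinSign u.2 * (heis q ^ t) (matUnit (prevPos u, 1) (prevPos v, 0)) (0, m) (0, m)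
        + (coinSign u.2 * coinSign v.2)
          * (heis q ^ t) (matUnit (prevPos u, 1) (prevPos v, 1)) (0, m) (0, m)) with hS
    have hstep : HasSum (fun j : Fin t → Option (ℤ × Fin 2) =>
        hadamardStep (pathAmp p m t j) u
          * (starRingEnd ℂ) (hadamardStep (pathAmp p m t j) v)) S := by
      convert! ((((ih (prevPos u, 0) (prevPos v, 0)).add
        ((ih (prevPos u, 0) (prevPos v, 1)).mul_left (coinSign v.2))).add
        ((ih (prevPos u, 1) (prevPos v, 0)).mul_left (coinSign u.2))).add
        ((ih (prevPos u, 1) (prevPos v, 1)).mul_left (coinSign u.2 * coinSign v.2))).mul_left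
        (1 / 2 : ℂ) using 1
      ext j
      have h2 : (Real.sqrt 2 : ℂ) * (Real.sqrt 2 : ℂ) = 2 := by
        rw [← Complex.ofReal_mul, Real.mul_self_sqrt (by norm_num)]; norm_num
      have hc : (starRingEnd ℂ) (coinSign v.2) = coinSign v.2 := by
        unfold coinSign; split_ifs <;> simp
      simp only [hadamardStep_apply, map_div₀, map_add, map_mul, Complex.conj_ofReal, hc]
      rw [div_mul_div_comm, h2]
      ring
    have hgoal : (heis q ^ (t + 1)) (matUnit u v) (0, m) (0, m)
        = q * S + (if u = v then (p : ℂ) * S else 0) := by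
      rw [pow_succ, Module.End.mul_apply, heis_matUnit]
      simp only [map_smul, map_add, Pi.smul_apply, Pi.add_apply, smul_eq_mul, hS]
      split_ifs
      · simp only [hq]; push_cast; ring
      · ring
    rw [hgoal]
    rw [← (Fin.snocEquiv (fun _ : Fin (t + 1) => Option (ℤ × Fin 2))).hasSum_iff]
    have hinj (o : Option (ℤ × Fin 2)) : Function.Injective
        (fun j : Fin t → Option (ℤ × Fin 2) => (o, j)) := fun a b h => by simpa using h
    have hext (o : Option (ℤ × Fin 2)) {a : (Fin t → Option (ℤ × Fin 2)) → ℂ} {s : ℂ}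
        (ha : HasSum a s) :
        HasSum (fun w : Option (ℤ × Fin 2) × (Fin t → Option (ℤ × Fin 2)) =>
          if w.1 = o then a w.2 else 0) s := by
      rw [← (hinj o).hasSum_iff]
      · simpa [Function.comp_def] using ha
      · rintro ⟨o', j⟩ h
        have : o' ≠ o := fun h' => h ⟨j, by simp [h']⟩
        simp [this]
    have hsq : (Real.sqrt (1 - p) : ℂ) * (Real.sqrt (1 - p) : ℂ) = q := by
      rw [← Complex.ofReal_mul, Real.mul_self_sqrt (by linarith)]
    have hsp : (Real.sqrt p : ℂ) * (Real.sqrt p : ℂ) = p := by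
      rw [← Complex.ofReal_mul, Real.mul_self_sqrt hp0]
    by_cases huv : u = v
    · subst huv
      convert! (hext none (hstep.mul_left q)).add (hext (some u) (hstep.mul_left (p : ℂ))) using 1
      · ext ⟨o, j⟩
        simp only [Function.comp_apply, Fin.snocEquiv_apply, pathAmp, Fin.snoc_last,
          Fin.snoc_castSucc]
        cases o with
        | none => simp [measOp, ← hsq]; ring
        | some w =>
          by_cases hw : u = w
          · subst hw; simp [measOp, ← hsp]; ring
          · simp [measOp, hw, Ne.symm hw]
      · simp
    · convert! hext none (hstep.mul_left q) using 1
      · ext ⟨o, j⟩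
        simp only [Function.comp_apply, Fin.snocEquiv_apply, pathAmp, Fin.snoc_last,
          Fin.snoc_castSucc]
        cases o with
        | none => simp [measOp, ← hsq]; ring
        | some w =>
          by_cases hw : u = w
          · subst hw; simp [measOp, Ne.symm huv]
          · simp [measOp, hw]
      · simp [huv]

lemma Pdec_eq (p : ℝ) (hp0 : 0 ≤ p) (hp1 : p ≤ 1) (m n : Fin 2) (x : ℤ) (t : ℕ) :
    ((Pdec p m n x t : ℝ) : ℂ)
      = (heis ((1 - p : ℝ) : ℂ) ^ t) (matUnit (x, n) (x, n)) (0, m) (0, m) := by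
  rw [← (hasSum_pathAmp p hp0 hp1 m t (x, n) (x, n)).tsum_eq, Pdec, Complex.ofReal_tsum]
  congr 1
  ext j
  rw [Complex.mul_conj, Complex.normSq_eq_norm_sq]

lemma hasSum_heis {ι : Type*} (q : ℂ) {O : ι → ℤ × Fin 2 → ℤ × Fin 2 → ℂ}
    {O' : ℤ × Fin 2 → ℤ × Fin 2 → ℂ} (h : ∀ u v, HasSum (fun i => O i u v) (O' u v))
    (t : ℕ) (u v : ℤ × Fin 2) :
    HasSum (fun i => (heis q ^ t) (O i) u v) ((heis q ^ t) O' u v) := by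
  induction t generalizing u v with
  | zero => simpa using h u v
  | succ t ih =>
    have hd (u v) : HasSum (fun i => damp q ((heis q ^ t) (O i)) u v)
        (damp q ((heis q ^ t) O') u v) := by
      unfold damp
      split_ifs
      · exact ih u v
      · exact (ih u v).mul_left q
    simp only [pow_succ', Module.End.mul_apply, heis_apply]
    exact ((((hd _ _).add ((hd _ _).mul_left _)).add ((hd _ _).mul_left _)).add
      ((hd _ _).mul_left _)).mul_left _

/-- The multiplication operator by a function of the position. -/
def posObs (χ : ℤ → ℂ) (u v : ℤ × Fin 2) : ℂ := if u = v then χ u.1 else 0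

/-- Expectations of functions of the position in the Heisenberg picture. -/
lemma hasSum_Ptilde (p : ℝ) (hp0 : 0 ≤ p) (hp1 : p ≤ 1) (χ : ℤ → ℂ) (t : ℕ) :
    HasSum (fun x : ℤ => χ x * (Ptilde p x t : ℂ))
      ((heis ((1 - p : ℝ) : ℂ) ^ t) (posObs χ) (0, 0) (0, 0)) := by
  have h (u v : ℤ × Fin 2) : HasSum
      (fun x : ℤ => (χ x • ∑ n : Fin 2, matUnit (x, n) (x, n)) u v) (posObs χ u v) := by
    obtain ⟨y, n⟩ := u
    have hy : posObs χ (y, n) v = (χ y • ∑ n : Fin 2, matUnit (y, n) (y, n)) (y, n) v := by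
      obtain ⟨z, n'⟩ := v
      fin_cases n <;> fin_cases n' <;> simp [posObs, matUnit, eq_comm]
    rw [hy]
    refine hasSum_single y fun x hx => ?_
    simp [matUnit, Ne.symm hx]
  convert! hasSum_heis ((1 - p : ℝ) : ℂ) h t (0, 0) (0, 0) using 1
  ext x
  simp [Ptilde, Pdec_eq p hp0 hp1, mul_add]

/-- Translation covariant symbols: functions of two coin states and half the position
difference. -/
abbrev Symb := Fin 2 → Fin 2 → ℤ → ℂ

/-- Damping of the off-diagonal part of a symbol. -/
def sdamp (q : ℂ) (f : Symb) (m n : Fin 2) (e : ℤ) : ℂ :=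
  if m = n ∧ e = 0 then f m n e else q * f m n e

/-- The Heisenberg step on symbols, with weights `a`, `b` on the diagonal coin sectors and `c`
on the off-diagonal ones. -/
def transfer (q a b c : ℂ) : Symb →ₗ[ℂ] Symb where
  toFun f m n e := (1 / 2) *
    (a * sdamp q f 0 0 e + coinSign n * (c * sdamp q f 0 1 (e - 1))
      + coinSign m * (c * sdamp q f 1 0 (e + 1))
      + coinSign m * coinSign n * (b * sdamp q f 1 1 e))
  map_add' f g := by
    ext m n e
    simp only [sdamp, Pi.add_apply]
    split_ifs <;> ring
  map_smul' s f := by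
    ext m n e
    simp only [sdamp, Pi.smul_apply, smul_eq_mul, RingHom.id_apply]
    split_ifs <;> ring

lemma transfer_apply (q a b c : ℂ) (f : Symb) (m n : Fin 2) (e : ℤ) :
    transfer q a b c f m n e = (1 / 2) *
    (a * sdamp q f 0 0 e + coinSign n * (c * sdamp q f 0 1 (e - 1))
      + coinSign m * (c * sdamp q f 1 0 (e + 1))
      + coinSign m * coinSign n * (b * sdamp q f 1 1 e)) := rfl

/-- The squared `ℓ²` norm of a symbol. -/
def energy (f : Symb) : ENNReal :=
  ∑' e : ℤ, (‖f 0 0 e‖ₑ ^ 2 + ‖f 0 1 e‖ₑ ^ 2 + ‖f 1 0 e‖ₑ ^ 2 + ‖f 1 1 e‖ₑ ^ 2)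

lemma enorm_sq_eq_ofReal (z : ℂ) : ‖z‖ₑ ^ 2 = ENNReal.ofReal (Complex.normSq z) := by
  rw [Complex.normSq_eq_norm_sq, ENNReal.ofReal_pow (norm_nonneg z), ofReal_norm]

lemma enorm_sq_parallelogram (a b c d : ℂ) :
    ‖(1 / 2) * (a + b + c + d)‖ₑ ^ 2 + ‖(1 / 2) * (a - b + c - d)‖ₑ ^ 2
      + ‖(1 / 2) * (a + b - c - d)‖ₑ ^ 2 + ‖(1 / 2) * (a - b - c + d)‖ₑ ^ 2
      = ‖a‖ₑ ^ 2 + ‖b‖ₑ ^ 2 + ‖c‖ₑ ^ 2 + ‖d‖ₑ ^ 2 := by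
  simp only [enorm_sq_eq_ofReal]
  have h0 := Complex.normSq_nonneg
  repeat rw [← ENNReal.ofReal_add (by simp only [add_nonneg, h0]) (h0 _)]
  congr 1
  simp only [Complex.normSq_apply, Complex.mul_re, Complex.mul_im, Complex.add_re, Complex.add_im,
    Complex.sub_re, Complex.sub_im, Complex.div_ofNat_re, Complex.div_ofNat_im, Complex.one_re,
    Complex.one_im]
  ring

lemma enorm_mul_sdamp_le {q a : ℂ} (hq : ‖q‖ ≤ 1) (ha : ‖a‖ ≤ 1) (f : Symb) (m n : Fin 2)
    (e : ℤ) : ‖a * sdamp q f m n e‖ₑ ^ 2 ≤ ‖f m n e‖ₑ ^ 2 := by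
  have hle (z w : ℂ) (hz : ‖z‖ ≤ 1) : ‖z * w‖ₑ ≤ ‖w‖ₑ := by
    rw [enorm_mul]
    refine mul_le_of_le_one_left' ?_
    rw [← ofReal_norm]
    exact ENNReal.ofReal_le_one.2 hz
  gcongr
  refine (hle _ _ ha).trans ?_
  unfold sdamp
  split_ifs
  · exact le_rfl
  · exact hle _ _ hq

lemma energy_transfer_le {q a b c : ℂ} (hq : ‖q‖ ≤ 1) (ha : ‖a‖ ≤ 1) (hb : ‖b‖ ≤ 1)
    (hc : ‖c‖ ≤ 1) (f : Symb) : energy (transfer q a b c f) ≤ energy f := by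
  have h : energy (transfer q a b c f) = ∑' e : ℤ, (‖a * sdamp q f 0 0 e‖ₑ ^ 2
      + ‖c * sdamp q f 0 1 (e - 1)‖ₑ ^ 2 + ‖c * sdamp q f 1 0 (e + 1)‖ₑ ^ 2
      + ‖b * sdamp q f 1 1 e‖ₑ ^ 2) := by
    unfold energy
    congr 1
    ext e
    rw [← enorm_sq_parallelogram (a * sdamp q f 0 0 e)]
    have h1 : coinSign 1 = -1 := by simp [coinSign]
    simp only [transfer_apply, h1, show coinSign 0 = 1 from rfl, one_mul, mul_one, neg_mul,
      mul_neg, neg_neg, sub_eq_add_neg]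
  rw [h]
  simp only [energy, ENNReal.tsum_add]
  have h1 := (Equiv.subRight (1 : ℤ)).tsum_eq (fun e => ‖c * sdamp q f 0 1 e‖ₑ ^ 2)
  have h2 := (Equiv.addRight (1 : ℤ)).tsum_eq (fun e => ‖c * sdamp q f 1 0 e‖ₑ ^ 2)
  simp only [Equiv.subRight_apply, Equiv.coe_addRight] at h1 h2
  rw [h1, h2]
  exact add_le_add (add_le_add (add_le_add
    (ENNReal.tsum_le_tsum fun e => enorm_mul_sdamp_le hq ha f _ _ e)
    (ENNReal.tsum_le_tsum fun e => enorm_mul_sdamp_le hq hc f _ _ e))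
    (ENNReal.tsum_le_tsum fun e => enorm_mul_sdamp_le hq hc f _ _ e))
    (ENNReal.tsum_le_tsum fun e => enorm_mul_sdamp_le hq hb f _ _ e)

lemma energy_transfer_pow_le {q a b c : ℂ} (hq : ‖q‖ ≤ 1) (ha : ‖a‖ ≤ 1) (hb : ‖b‖ ≤ 1)
    (hc : ‖c‖ ≤ 1) (f : Symb) (t : ℕ) : energy ((transfer q a b c ^ t) f) ≤ energy f := by
  induction t with
  | zero => simp
  | succ t ih =>
    rw [pow_succ', Module.End.mul_apply]
    exact (energy_transfer_le hq ha hb hc _).trans ih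

lemma norm_apply_le_of_energy_le {f g : Symb} (hf : energy f ≠ ⊤) (h : energy g ≤ energy f) :
    ‖g 0 0 0‖ ≤ (energy f).toReal + 1 := by
  have h1 : ‖g 0 0 0‖ₑ ^ 2 ≤ energy g := by
    refine le_trans ?_ (ENNReal.le_tsum 0)
    simp only [add_assoc]
    exact le_self_add
  have h2 := ENNReal.toReal_mono hf (h1.trans h)
  rw [ENNReal.toReal_pow, toReal_enorm] at h2
  nlinarith [sq_nonneg (‖g 0 0 0‖ - 1)]

lemma energy_ne_top {f : Symb} (h : ∀ m n, Summable fun e => ‖f m n e‖) : energy f ≠ ⊤ := by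
  have key (m n : Fin 2) : ∑' e : ℤ, ‖f m n e‖ₑ ^ 2 ≠ ⊤ := by
    have hs : ∑' e : ℤ, ‖f m n e‖ₑ ≠ ⊤ := by
      simpa only [ofReal_norm] using (h m n).tsum_ofReal_ne_top
    refine ne_top_of_le_ne_top (ENNReal.mul_ne_top hs hs) ?_
    rw [← ENNReal.tsum_mul_right]
    refine ENNReal.tsum_le_tsum fun e => ?_
    rw [pow_two]
    gcongr
    exact ENNReal.le_tsum e
  simp only [energy, ENNReal.tsum_add]
  simp [key]

lemma damp_apply_add (q : ℂ) (O : ℤ × Fin 2 → ℤ × Fin 2 → ℂ) (x e : ℤ) (m n : Fin 2) :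
    damp q O (x, m) (x + 2 * e, n) =
      if m = n ∧ e = 0 then O (x, m) (x + 2 * e, n) else q * O (x, m) (x + 2 * e, n) := by
  have : ((x, m) = (x + 2 * e, n)) ↔ (m = n ∧ e = 0) := by
    simp only [Prod.mk.injEq]
    omega
  simp only [damp, this]

/-- The Heisenberg step in terms of half the position difference. -/
lemma heis_apply_add (q : ℂ) (O : ℤ × Fin 2 → ℤ × Fin 2 → ℂ) (x e : ℤ) (m n : Fin 2) :
    heis q O (x, m) (x + 2 * e, n) = (1 / 2) *
    (damp q O (x + 1, 0) (x + 1 + 2 * e, 0)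
      + coinSign n * damp q O (x + 1, 0) (x + 1 + 2 * (e - 1), 1)
      + coinSign m * damp q O (x - 1, 1) (x - 1 + 2 * (e + 1), 0)
      + coinSign m * coinSign n * damp q O (x - 1, 1) (x - 1 + 2 * e, 1)) := by
  rw [heis_apply]
  simp only
  ring_nf

/-- The Heisenberg step preserves observables given by a character times a symbol. -/
lemma heis_covariant (q : ℂ) (k : ℝ) {O : ℤ × Fin 2 → ℤ × Fin 2 → ℂ} {f : Symb}
    (h : ∀ (x e : ℤ) m n,
      O (x, m) (x + 2 * e, n) = Complex.exp (Complex.I * k * (x + e)) * f m n e)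
    (x e : ℤ) (m n : Fin 2) :
    heis q O (x, m) (x + 2 * e, n) = Complex.exp (Complex.I * k * (x + e)) *
      transfer q (Complex.exp (Complex.I * k)) (Complex.exp (-(Complex.I * k))) 1 f m n e := by
  have hd (x e : ℤ) (m n : Fin 2) : damp q O (x, m) (x + 2 * e, n)
      = Complex.exp (Complex.I * k * (x + e)) * sdamp q f m n e := by
    rw [damp_apply_add, h, sdamp]
    split_ifs <;> ring
  have e1 : Complex.exp (Complex.I * k * (x + 1 + e))
      = Complex.exp (Complex.I * k * (x + e)) * Complex.exp (Complex.I * k) := by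
    rw [← Complex.exp_add]; ring_nf
  have e2 : Complex.exp (Complex.I * k * (x - 1 + e))
      = Complex.exp (Complex.I * k * (x + e)) * Complex.exp (-(Complex.I * k)) := by
    rw [← Complex.exp_add]; ring_nf
  have e3 : (x : ℂ) + 1 + (e - 1) = x + e := by ring
  have e4 : (x : ℂ) - 1 + (e + 1) = x + e := by ring
  rw [heis_apply_add]
  simp only [hd, transfer_apply]
  push_cast
  rw [e1, e2, e3, e4]
  ring

/-- The Heisenberg step preserves observables that are affine in the position. -/
lemma heis_affine (q : ℂ) {O : ℤ × Fin 2 → ℤ × Fin 2 → ℂ} {f g : Symb}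
    (h : ∀ (x e : ℤ) m n, O (x, m) (x + 2 * e, n) = (x + e) * f m n e + g m n e)
    (x e : ℤ) (m n : Fin 2) :
    heis q O (x, m) (x + 2 * e, n) = (x + e) * transfer q 1 1 1 f m n e
      + (transfer q 1 1 1 g + transfer q 1 (-1) 0 f) m n e := by
  have hd (x e : ℤ) (m n : Fin 2) : damp q O (x, m) (x + 2 * e, n)
      = (x + e) * sdamp q f m n e + sdamp q g m n e := by
    rw [damp_apply_add, h, sdamp, sdamp]
    split_ifs <;> ring
  rw [heis_apply_add]
  simp only [hd, transfer_apply, Pi.add_apply]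
  push_cast
  ring

/-- The symbol of the identity. -/
def idSymb : Symb := fun m n e => if m = n ∧ e = 0 then 1 else 0

lemma transfer_idSymb (q : ℂ) : transfer q 1 1 1 idSymb = idSymb := by
  ext m n e
  simp only [transfer_apply]
  fin_cases m <;> fin_cases n <;> by_cases he : e = 0 <;>
    simp [sdamp, idSymb, coinSign, he] <;> norm_num

lemma posObs_eq (χ : ℤ → ℂ) (x e : ℤ) (m n : Fin 2) :
    posObs χ (x, m) (x + 2 * e, n) = χ x * idSymb m n e := by
  have : ((x, m) = (x + 2 * e, n)) ↔ (m = n ∧ e = 0) := by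
    simp only [Prod.mk.injEq]
    omega
  simp only [posObs, idSymb, this, mul_ite, mul_one, mul_zero]

lemma transfer_pow_idSymb (q : ℂ) (t : ℕ) : (transfer q 1 1 1 ^ t) idSymb = idSymb := by
  induction t with
  | zero => simp
  | succ t ih => rw [pow_succ, Module.End.mul_apply, transfer_idSymb, ih]

/-- The Heisenberg step on symbols at momentum `k`. -/
def transferAt (q : ℂ) (k : ℝ) : Symb →ₗ[ℂ] Symb :=
  transfer q (Complex.exp (Complex.I * k)) (Complex.exp (-(Complex.I * k))) 1

lemma hasSum_char (p : ℝ) (hp0 : 0 ≤ p) (hp1 : p ≤ 1) (k : ℝ) (t : ℕ) :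
    HasSum (fun x : ℤ => (Ptilde p x t : ℂ) * Complex.exp (Complex.I * k * x))
      ((transferAt ((1 - p : ℝ) : ℂ) k ^ t) idSymb 0 0 0) := by
  have h := hasSum_Ptilde p hp0 hp1 (fun x => Complex.exp (Complex.I * k * x)) t
  have key (x e : ℤ) (m n : Fin 2) :
      (heis ((1 - p : ℝ) : ℂ) ^ t) (posObs fun x => Complex.exp (Complex.I * k * x)) (x, m)
          (x + 2 * e, n)
        = Complex.exp (Complex.I * k * (x + e)) *
          (transferAt ((1 - p : ℝ) : ℂ) k ^ t) idSymb m n e := by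
    clear h
    induction t generalizing x e m n with
    | zero =>
      simp only [pow_zero, Module.End.one_apply, posObs_eq, idSymb]
      split_ifs with h
      · simp [h.2]
      · simp
    | succ t ih =>
      simp only [pow_succ', Module.End.mul_apply]
      exact heis_covariant _ _ ih x e m n
  have h0 := key 0 0 0 0
  simp only [Int.cast_zero, add_zero, mul_zero, Complex.exp_zero, one_mul] at h0
  rw [h0] at h
  simpa only [mul_comm] using h

lemma hasSum_Ptilde_one (p : ℝ) (hp0 : 0 ≤ p) (hp1 : p ≤ 1) (t : ℕ) :
    HasSum (fun x : ℤ => Ptilde p x t) 1 := by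
  have h := hasSum_char p hp0 hp1 0 t
  simp only [transferAt, Complex.ofReal_zero, mul_zero, neg_zero, Complex.exp_zero, zero_mul,
    transfer_pow_idSymb, mul_one] at h
  rw [← Complex.hasSum_ofReal]
  simpa [idSymb] using h

lemma norm_transferAt_pow_le {q : ℂ} (hq : ‖q‖ ≤ 1) {f : Symb} (hf : energy f ≠ ⊤) (k : ℝ)
    (t : ℕ) : ‖(transferAt q k ^ t) f 0 0 0‖ ≤ (energy f).toReal + 1 := by
  refine norm_apply_le_of_energy_le hf (energy_transfer_pow_le hq ?_ ?_ (by simp) f t)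
  · rw [mul_comm, Complex.norm_exp_ofReal_mul_I]
  · rw [show -(Complex.I * (k : ℂ)) = ((-k : ℝ) : ℂ) * Complex.I by push_cast; ring,
      Complex.norm_exp_ofReal_mul_I]

lemma transferAt_zero (q : ℂ) : transferAt q 0 = transfer q 1 1 1 := by
  simp [transferAt]

/-- The mean stays bounded as soon as the first-order cell problem is solvable. -/
lemma abs_tildeMean_le (p : ℝ) (hp0 : 0 ≤ p) (hp1 : p ≤ 1) {f : Symb} (hf : energy f ≠ ⊤)
    (h : transfer ((1 - p : ℝ) : ℂ) 1 1 1 f + transfer ((1 - p : ℝ) : ℂ) 1 (-1) 0 idSymb = f)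
    (t : ℕ) : |tildeMean p t| ≤ 2 * ((energy f).toReal + 1) := by
  set q : ℂ := ((1 - p : ℝ) : ℂ) with hq
  have hq1 : ‖q‖ ≤ 1 := by
    rw [hq, Complex.norm_real, Real.norm_eq_abs, abs_le]
    constructor <;> linarith
  have key (x e : ℤ) (m n : Fin 2) :
      (heis q ^ t) (posObs fun x => (x : ℂ)) (x, m) (x + 2 * e, n)
        = (x + e) * idSymb m n e + (f - (transfer q 1 1 1 ^ t) f) m n e := by
    induction t generalizing x e m n with
    | zero =>
      simp only [pow_zero, Module.End.one_apply, posObs_eq, idSymb]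
      split_ifs with h
      · simp [h.2]
      · simp
    | succ t ih =>
      rw [pow_succ', Module.End.mul_apply, heis_affine _ ih x e m n, transfer_idSymb, map_sub,
        pow_succ', Module.End.mul_apply]
      congr 1
      nth_rewrite 3 [← h]
      simp only [Pi.add_apply, Pi.sub_apply]
      ring
  have hs := (hasSum_Ptilde p hp0 hp1 (fun x => (x : ℂ)) t).tsum_eq
  have h0 := key 0 0 0 0
  simp only [Int.cast_zero, add_zero, mul_zero, zero_mul, zero_add] at h0
  rw [h0] at hs
  have hm : ((tildeMean p t : ℝ) : ℂ) = (f - (transfer q 1 1 1 ^ t) f) 0 0 0 := by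
    rw [← hs, tildeMean, Complex.ofReal_tsum]
    simp
  rw [← Real.norm_eq_abs, ← Complex.norm_real, hm, ← transferAt_zero]
  have b0 := norm_transferAt_pow_le hq1 hf 0 0
  have b1 := norm_transferAt_pow_le hq1 hf 0 t
  simp only [pow_zero, Module.End.one_apply] at b0
  simp only [Pi.sub_apply]
  linarith [norm_sub_le (f 0 0 0) ((transferAt q 0 ^ t) f 0 0 0)]

/-- A two-sided geometric sequence with ratio `l`. -/
def twoSided (a b l : ℂ) (e : ℤ) : ℂ := if 0 ≤ e then a * l ^ e.toNat else b * l ^ (-e - 1).toNat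

lemma twoSided_natCast (a b l : ℂ) (n : ℕ) : twoSided a b l n = a * l ^ n := by
  simp [twoSided]

lemma twoSided_neg (a b l : ℂ) (n : ℕ) : twoSided a b l (-(n + 1)) = b * l ^ n := by
  have h : ¬ (0 : ℤ) ≤ -(n + 1) := by omega
  have h' : (-(-((n : ℤ) + 1)) - 1).toNat = n := by omega
  rw [twoSided, if_neg h, h']

lemma summable_norm_twoSided (a b : ℂ) {l : ℂ} (hl : ‖l‖ < 1) :
    Summable fun e => ‖twoSided a b l e‖ := by
  have hs := summable_geometric_of_lt_one (norm_nonneg l) hl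
  refine Summable.of_nat_of_neg_add_one ?_ ?_
  · simpa only [twoSided_natCast, norm_mul, norm_pow] using hs.mul_left ‖a‖
  · simpa only [twoSided_neg, norm_mul, norm_pow] using hs.mul_left ‖b‖

/-- The diagonal part of the first corrector. -/
def corrDiag (q a b l : ℂ) (e : ℤ) : ℂ :=
  q * (twoSided a b l (e - 1) + twoSided a b l (-(e + 1)))

/-- The first-order corrector. -/
def corrOne (q a b l : ℂ) : Symb := fun m n e =>
  !![corrDiag q a b l e / 2, twoSided a b l e; twoSided a b l (-e), -(corrDiag q a b l e / 2)] m n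

/-- The second-order corrector. -/
def corrTwo (q a b l : ℂ) : Symb := fun m n e =>
  if m = n ∧ e ≠ 0 then q / (1 - q) * (corrDiag q a b l e / 2) else 0

lemma corrDiag_zero (q a b l : ℂ) : corrDiag q a b l 0 = 2 * (q * b) := by
  have := twoSided_neg a b l 0
  simp only [Nat.cast_zero, zero_add, pow_zero, mul_one] at this
  simp only [corrDiag, zero_sub, zero_add, this]
  ring

lemma corrDiag_natCast (q a b l : ℂ) (n : ℕ) :
    corrDiag q a b l (n + 1) = q * (a * l ^ n + b * l ^ (n + 1)) := by
  have h := twoSided_neg a b l (n + 1)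
  push_cast at h
  rw [corrDiag, h, add_sub_cancel_right, twoSided_natCast]

lemma corrDiag_neg (q a b l : ℂ) (n : ℕ) :
    corrDiag q a b l (-(n + 1)) = q * (b * l ^ (n + 1) + a * l ^ n) := by
  have h := twoSided_neg a b l (n + 1)
  push_cast at h
  rw [corrDiag, show -((n : ℤ) + 1) - 1 = -(n + 1 + 1) by ring, h,
    show -(-((n : ℤ) + 1) + 1) = n by ring, twoSided_natCast]

lemma summable_norm_corrDiag (q a b : ℂ) {l : ℂ} (hl : ‖l‖ < 1) :
    Summable fun e : ℤ => ‖corrDiag q a b l e / 2‖ := by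
  have hs : Summable (twoSided a b l) := (summable_norm_twoSided a b hl).of_norm
  have h1 : Summable fun e : ℤ => twoSided a b l (e - 1) :=
    hs.comp_injective (sub_left_injective (b := (1 : ℤ)))
  have h2 : Summable fun e : ℤ => twoSided a b l (-(e + 1)) :=
    hs.comp_injective (neg_injective.comp (add_left_injective (1 : ℤ)))
  exact (((h1.add h2).mul_left q).div_const 2).norm

lemma energy_corrOne_ne_top (q a b : ℂ) {l : ℂ} (hl : ‖l‖ < 1) :
    energy (corrOne q a b l) ≠ ⊤ := by
  have hs := summable_norm_twoSided a b hl
  have hn : Summable fun e : ℤ => ‖twoSided a b l (-e)‖ :=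
    hs.comp_injective (neg_injective (G := ℤ))
  have hd := summable_norm_corrDiag q a b hl
  refine energy_ne_top ?_
  simp only [Fin.forall_fin_two, corrOne, Matrix.of_apply, Matrix.cons_val', Matrix.cons_val_zero,
    Matrix.cons_val_one, Matrix.cons_val_fin_one, norm_neg]
  exact ⟨⟨hd, hs⟩, hn, hd⟩

lemma energy_corrTwo_ne_top (q a b : ℂ) {l : ℂ} (hl : ‖l‖ < 1) :
    energy (corrTwo q a b l) ≠ ⊤ := by
  refine energy_ne_top fun m n => Summable.of_nonneg_of_le (fun e => norm_nonneg _) (fun e => ?_)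
    ((summable_norm_corrDiag q a b hl).mul_left ‖q / (1 - q)‖)
  unfold corrTwo
  split_ifs
  · exact (norm_mul _ _).le
  · rw [norm_zero]
    positivity

lemma energy_idSymb_ne_top : energy idSymb ≠ ⊤ := by
  refine energy_ne_top fun m n => summable_of_hasFiniteSupport ?_
  refine (Set.finite_singleton (0 : ℤ)).subset fun e he => ?_
  by_contra h
  exact he (by simp [idSymb, show e ≠ 0 from h])

lemma corrOne_cell {q a b l : ℂ} (h1 : a * (l + q) = b * (1 + q * l))
    (h2 : a * (l - q ^ 2) = b * (q ^ 2 * l - 1)) (h3 : a = 1 + q * b) :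
    transfer q 1 1 1 (corrOne q a b l) + transfer q 1 (-1) 0 idSymb = corrOne q a b l := by
  have hcases (e : ℤ) : e = 0 ∨ (∃ n : ℕ, e = n + 1) ∨ ∃ n : ℕ, e = -(n + 1) := by
    rcases lt_trichotomy e 0 with h | h | h
    · exact .inr (.inr ⟨(-e - 1).toNat, by omega⟩)
    · exact .inl h
    · exact .inr (.inl ⟨(e - 1).toNat, by omega⟩)
  have hN (e : ℤ) : (1 / 2) * ((if e = 0 then 1 else q) * corrDiag q a b l e
      - q * twoSided a b l (e - 1) + q * twoSided a b l (-(e + 1)))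
        + (if e = 0 then 1 else 0) = twoSided a b l e := by
    rcases hcases e with rfl | ⟨n, rfl⟩ | ⟨n, rfl⟩
    · have h0 := twoSided_neg a b l 0
      have h0' := twoSided_natCast a b l 0
      simp only [Nat.cast_zero, zero_add, pow_zero, mul_one] at h0 h0'
      simp only [corrDiag_zero, zero_sub, zero_add, h0, h0', if_true]
      linear_combination -h3
    · have h0 := twoSided_neg a b l (n + 1)
      have h0' := twoSided_natCast a b l (n + 1)
      push_cast at h0 h0'
      rw [corrDiag_natCast, add_sub_cancel_right, twoSided_natCast, h0, h0',
        if_neg (by omega), if_neg (by omega)]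
      linear_combination (-(1 / 2) * l ^ n) * (h1 + h2)
    · have h0 := twoSided_neg a b l (n + 1)
      push_cast at h0
      rw [corrDiag_neg, show -((n : ℤ) + 1) - 1 = -(n + 1 + 1) by ring, h0,
        show -(-((n : ℤ) + 1) + 1) = n by ring, twoSided_natCast, twoSided_neg,
        if_neg (by omega), if_neg (by omega)]
      linear_combination (1 / 2 * l ^ n) * (h1 - h2)
  have hsymm (e : ℤ) : corrDiag q a b l (-e) = corrDiag q a b l e := by
    rw [corrDiag, corrDiag, neg_add', neg_neg, ← neg_add', add_comm (twoSided _ _ _ _)]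
  ext m n e
  have hM := hN (-e)
  have hN := hN e
  rw [hsymm, show -(-e + 1) = e - 1 by ring, show -e - 1 = -(e + 1) by ring] at hM
  have hd : corrDiag q a b l e = q * (twoSided a b l (e - 1) + twoSided a b l (-(e + 1))) := rfl
  fin_cases m <;> fin_cases n <;> by_cases he : e = 0 <;>
    simp [transfer_apply, sdamp, corrOne, coinSign, idSymb, he] at hM hN hd ⊢
  · linear_combination -(1 / 2) * hd
  · linear_combination -(1 / 2) * hd
  · linear_combination hN
  · linear_combination hN
  · linear_combination hM
  · linear_combination hM
  · linear_combination (1 / 2) * hd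
  · linear_combination (1 / 2) * hd

lemma corrTwo_cell {q a b l : ℂ} (hq : 1 - q ≠ 0) :
    transfer q 1 1 1 (corrTwo q a b l) + transfer q 1 (-1) 0 (corrOne q a b l)
      - (q * b) • idSymb = corrTwo q a b l := by
  ext m n e
  by_cases he : e = 0
  · subst he
    fin_cases m <;> fin_cases n <;>
      simp [transfer_apply, sdamp, corrTwo, corrOne, coinSign, idSymb, corrDiag_zero] <;> ring
  · fin_cases m <;> fin_cases n <;>
      simp [transfer_apply, sdamp, corrTwo, corrOne, coinSign, idSymb, he] <;> field_simp <;> ring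

/-- The parameters of the correctors. -/
lemma exists_params {q : ℝ} (h0 : 0 ≤ q) (h1 : q < 1) :
    ∃ a b l : ℝ, |l| < 1 ∧ a * (l + q) = b * (1 + q * l) ∧
      a * (l - q ^ 2) = b * (q ^ 2 * l - 1) ∧ a = 1 + q * b ∧
      1 + 2 * (q * b) = (1 - q + 2 * Real.sqrt (1 + q ^ 2) - 2) / (1 - q) := by
  set r := Real.sqrt (1 + q ^ 2) with hr
  have hr2 : r ^ 2 = 1 + q ^ 2 := Real.sq_sqrt (by positivity)
  have hr0 : 0 ≤ r := Real.sqrt_nonneg _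
  set D := 1 + q + q ^ 2 + (1 + q) * r with hD
  have hD0 : 0 < D := by positivity
  have hqD : q < D := by nlinarith [mul_nonneg h0 hr0]
  have hp : 1 - q ≠ 0 := by linarith
  have hp2 : 1 - q ^ 2 ≠ 0 := by nlinarith
  have hquad : D ^ 2 + q ^ 2 = 2 * (1 + q + q ^ 2) * D := by
    rw [hD]; linear_combination (1 + q) ^ 2 * hr2
  have hl : q * (-q / D + q) = (1 + q) * (r - 1) := by
    field_simp
    rw [hD]; linear_combination (-(1 + q) ^ 2) * hr2
  refine ⟨(1 + q * (-q / D)) / (1 - q ^ 2), (-q / D + q) / (1 - q ^ 2), -q / D, ?_, ?_, ?_, ?_, ?_⟩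
  · rw [abs_div, abs_neg, abs_of_nonneg h0, abs_of_pos hD0, div_lt_one hD0]
    exact hqD
  · field_simp
  · field_simp
    linear_combination (q - q ^ 2) * hquad
  · field_simp
    ring
  · rw [mul_div_assoc', hl]
    field_simp
    ring

lemma transferAt_eq (q : ℂ) (k : ℝ) (f : Symb) : transferAt q k f = transfer q 1 1 1 f
    + (Complex.I * Real.sin k) • transfer q 1 (-1) 0 f
    + ((Real.cos k : ℂ) - 1) • transfer q 1 1 0 f := by
  have h1 : Complex.exp (Complex.I * k) = Real.cos k + Complex.I * Real.sin k := by
    rw [mul_comm, Complex.exp_mul_I]; push_cast; ring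
  have h2 : Complex.exp (-(Complex.I * k)) = Real.cos k - Complex.I * Real.sin k := by
    rw [show -(Complex.I * (k : ℂ)) = (-k : ℂ) * Complex.I by ring, Complex.exp_mul_I]
    simp; ring
  ext m n e
  simp only [transferAt, transfer_apply, Pi.add_apply, Pi.smul_apply, smul_eq_mul, h1, h2]
  ring

lemma transfer_one_one_zero_idSymb (q : ℂ) : transfer q 1 1 0 idSymb = idSymb := by
  ext m n e
  simp only [transfer_apply]
  fin_cases m <;> fin_cases n <;> by_cases he : e = 0 <;>
    simp [sdamp, idSymb, coinSign, he] <;> norm_num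

/-- The coefficients of the residual in the approximate eigenvalue equation. -/
def residualCoeff (v k : ℝ) : Fin 8 → ℂ :=
  ![((Real.cos k - Real.exp (-(v / 2) * k ^ 2) + k ^ 2 * ((1 - v) / 2) : ℝ) : ℂ),
    Complex.I * ((Real.sin k - k : ℝ) : ℂ),
    ((k * (k - Real.sin k) : ℝ) : ℂ),
    -(Complex.I * ((k ^ 2 * Real.sin k : ℝ) : ℂ)),
    Complex.I * ((k * (Real.cos k - 1) : ℝ) : ℂ),
    -((k ^ 2 * (Real.cos k - 1) : ℝ) : ℂ),
    Complex.I * ((k * (1 - Real.exp (-(v / 2) * k ^ 2)) : ℝ) : ℂ),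
    -((k ^ 2 * (1 - Real.exp (-(v / 2) * k ^ 2)) : ℝ) : ℂ)]

/-- The symbols appearing in the residual of the approximate eigenvalue equation. -/
def residualSymb (q : ℂ) (f g : Symb) : Fin 8 → Symb :=
  ![idSymb, transfer q 1 (-1) 0 idSymb, transfer q 1 (-1) 0 f, transfer q 1 (-1) 0 g,
    transfer q 1 1 0 f, transfer q 1 1 0 g, f, g]

lemma norm_residualCoeff_le {v k : ℝ} (hv : 0 ≤ v) (hk : |k| ≤ 1) (i : Fin 8) :
    ‖residualCoeff v k i‖ ≤ (1 + v + v ^ 2) * |k| ^ 3 := by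
  set c := |k| with hc
  have hc0 : 0 ≤ c := abs_nonneg k
  have hk2 : k ^ 2 = c ^ 2 := (sq_abs k).symm
  have hc43 : c ^ 4 ≤ c ^ 3 := pow_le_pow_of_le_one hc0 hk (by norm_num)
  have hc53 : c ^ 5 ≤ c ^ 3 := pow_le_pow_of_le_one hc0 hk (by norm_num)
  have hc3 : 0 ≤ c ^ 3 := by positivity
  have hc4 : 0 ≤ c ^ 4 := by positivity
  have hM : c ^ 3 ≤ (1 + v + v ^ 2) * c ^ 3 := by nlinarith [mul_nonneg hv hc3]
  have hcos := Real.cos_bound hk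
  rw [← hc, hk2] at hcos
  have hsin : |Real.sin k - k| ≤ c ^ 3 := by
    have h := Real.sin_bound hk
    have h3 : |k ^ 3 / 6| = c ^ 3 / 6 := by
      rw [abs_div, abs_pow, abs_of_pos (by norm_num : (0 : ℝ) < 6)]
    calc |Real.sin k - k| = |(Real.sin k - (k - k ^ 3 / 6)) - k ^ 3 / 6| := by ring_nf
      _ ≤ c ^ 5 / 100 + c ^ 3 / 6 := (abs_sub _ _).trans (by rw [h3]; gcongr)
      _ ≤ c ^ 3 := by linarith
  have hsin1 : |Real.sin k| ≤ c := Real.abs_sin_le_abs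
  have hcos1 : |Real.cos k - 1| ≤ c ^ 2 := by
    have h := Real.one_sub_sq_div_two_le_cos (x := k)
    rw [abs_le]
    constructor <;> nlinarith [Real.cos_le_one k]
  set y := v / 2 * c ^ 2 with hy
  have hy0 : 0 ≤ y := by positivity
  have hyE : -(v / 2) * k ^ 2 = -y := by rw [hk2, hy]; ring
  have he1 := Real.add_one_le_exp (-y)
  have he2 : Real.exp (-y) ≤ 1 := Real.exp_le_one_iff.2 (by linarith)
  have he3 : Real.exp (-y) - 1 + y ≤ y ^ 2 := by
    have h1 : Real.exp (-y) * Real.exp y = 1 := by rw [← Real.exp_add]; simp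
    have h2 := Real.add_one_le_exp y
    nlinarith [Real.exp_pos (-y), mul_nonneg hy0 hy0]
  have he : |1 - Real.exp (-y)| ≤ y := by
    rw [abs_le]
    constructor <;> linarith
  have hyv : c * y ≤ (1 + v + v ^ 2) * c ^ 3 := by
    rw [hy]; nlinarith [mul_nonneg hv hc3, mul_nonneg (sq_nonneg v) hc3]
  fin_cases i
  · show ‖((_ : ℝ) : ℂ)‖ ≤ _
    rw [Complex.norm_real, Real.norm_eq_abs, hyE, hk2]
    rw [abs_le] at hcos ⊢
    have hy2 : y ^ 2 ≤ v ^ 2 * c ^ 3 := by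
      rw [hy]
      nlinarith [mul_nonneg (sq_nonneg v) hc4, mul_nonneg (sq_nonneg v) (sub_nonneg.2 hc43)]
    have hv3 := mul_nonneg hv hc3
    constructor <;> nlinarith
  · show ‖Complex.I * ((_ : ℝ) : ℂ)‖ ≤ _
    rw [norm_mul, Complex.norm_I, one_mul, Complex.norm_real, Real.norm_eq_abs]
    exact hsin.trans hM
  · show ‖((_ : ℝ) : ℂ)‖ ≤ _
    rw [Complex.norm_real, Real.norm_eq_abs, abs_mul, abs_sub_comm]
    exact (mul_le_of_le_one_left (abs_nonneg _) hk).trans (hsin.trans hM)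
  · show ‖-(Complex.I * ((_ : ℝ) : ℂ))‖ ≤ _
    rw [norm_neg, norm_mul, Complex.norm_I, one_mul, Complex.norm_real, Real.norm_eq_abs, abs_mul,
      hk2, abs_of_nonneg (sq_nonneg c)]
    exact le_trans (by nlinarith [mul_le_mul_of_nonneg_left hsin1 (sq_nonneg c)]) hM
  · show ‖Complex.I * ((_ : ℝ) : ℂ)‖ ≤ _
    rw [norm_mul, Complex.norm_I, one_mul, Complex.norm_real, Real.norm_eq_abs, abs_mul]
    exact le_trans (by nlinarith [mul_le_mul_of_nonneg_left hcos1 hc0]) hM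
  · show ‖-((_ : ℝ) : ℂ)‖ ≤ _
    rw [norm_neg, Complex.norm_real, Real.norm_eq_abs, abs_mul, hk2, abs_of_nonneg (sq_nonneg c)]
    exact le_trans (by nlinarith [mul_le_mul_of_nonneg_left hcos1 (sq_nonneg c)]) hM
  · show ‖Complex.I * ((_ : ℝ) : ℂ)‖ ≤ _
    rw [norm_mul, Complex.norm_I, one_mul, Complex.norm_real, Real.norm_eq_abs, abs_mul, hyE]
    exact (mul_le_mul_of_nonneg_left he hc0).trans hyv
  · show ‖-((_ : ℝ) : ℂ)‖ ≤ _
    rw [norm_neg, Complex.norm_real, Real.norm_eq_abs, abs_mul, hyE, hk2,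
      abs_of_nonneg (sq_nonneg c)]
    refine le_trans ?_ hyv
    nlinarith [mul_le_mul_of_nonneg_left he (sq_nonneg c),
      mul_nonneg (mul_nonneg hc0 hy0) (sub_nonneg.2 hk)]

lemma energy_residualSymb_ne_top {q : ℂ} (hq : ‖q‖ ≤ 1) {f g : Symb} (hf : energy f ≠ ⊤)
    (hg : energy g ≠ ⊤) (i : Fin 8) : energy (residualSymb q f g i) ≠ ⊤ := by
  have hT (b : ℂ) (hb : ‖b‖ ≤ 1) {h : Symb} (hh : energy h ≠ ⊤) :
      energy (transfer q 1 b 0 h) ≠ ⊤ :=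
    ne_top_of_le_ne_top hh (energy_transfer_le hq (by simp) hb (by simp) h)
  fin_cases i
  · exact energy_idSymb_ne_top
  · exact hT _ (by simp) energy_idSymb_ne_top
  · exact hT _ (by simp) hf
  · exact hT _ (by simp) hg
  · exact hT _ (by simp) hf
  · exact hT _ (by simp) hg
  · exact hf
  · exact hg

/-- The approximate eigenfunction of `transferAt q k`. -/
def approxEigen (k : ℝ) (f g : Symb) : Symb :=
  idSymb + (Complex.I * k) • f - ((k : ℂ) ^ 2) • g

lemma transferAt_approxEigen {q : ℂ} {v : ℝ} {f g : Symb}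
    (hf : transfer q 1 1 1 f + transfer q 1 (-1) 0 idSymb = f)
    (hg : transfer q 1 1 1 g + transfer q 1 (-1) 0 f - (((v : ℂ) - 1) / 2) • idSymb = g) (k : ℝ) :
    transferAt q k (approxEigen k f g) =
      ((Real.exp (-(v / 2) * k ^ 2) : ℝ) : ℂ) • approxEigen k f g
        + ∑ i, residualCoeff v k i • residualSymb q f g i := by
  have hf' : transfer q 1 1 1 f = f - transfer q 1 (-1) 0 idSymb := eq_sub_of_add_eq hf
  have hg' : transfer q 1 1 1 g = g - transfer q 1 (-1) 0 f + (((v : ℂ) - 1) / 2) • idSymb := by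
    nth_rewrite 2 [← hg]
    abel
  simp only [approxEigen, map_add, map_sub, map_smul, transferAt_eq, transfer_idSymb,
    transfer_one_one_zero_idSymb, hf', hg', Fin.sum_univ_eight, residualCoeff, residualSymb]
  generalize transfer q 1 (-1) 0 idSymb = a
  generalize transfer q 1 (-1) 0 f = b
  generalize transfer q 1 (-1) 0 g = c
  generalize transfer q 1 1 0 f = d
  generalize transfer q 1 1 0 g = e
  generalize idSymb = w
  ext m n x
  simp only [Pi.add_apply, Pi.sub_apply, Pi.smul_apply, smul_eq_mul, Matrix.cons_val]
  push_cast
  ring_nf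
  rw [Complex.I_sq]
  ring
lemma Ptilde_nonneg (p : ℝ) (x : ℤ) (t : ℕ) : 0 ≤ Ptilde p x t :=
  Finset.sum_nonneg fun _ _ => tsum_nonneg fun _ => by positivity

lemma nonneg_variance {p v : ℝ} (hp0 : 0 < p)
    (hv : v = (p + 2 * Real.sqrt (1 + (1 - p) ^ 2) - 2) / p) : 0 ≤ v := by
  have h : 1 ≤ Real.sqrt (1 + (1 - p) ^ 2) := Real.one_le_sqrt.2 (by nlinarith [sq_nonneg (1 - p)])
  rw [hv]
  exact div_nonneg (by linarith) hp0.le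

lemma exists_norm_charTilde_sub_le (p : ℝ) (hp0 : 0 ≤ p) (hp1 : p ≤ 1) {v : ℝ} (hv : 0 ≤ v)
    {f g : Symb} (hfe : energy f ≠ ⊤) (hge : energy g ≠ ⊤)
    (hf : transfer ((1 - p : ℝ) : ℂ) 1 1 1 f + transfer ((1 - p : ℝ) : ℂ) 1 (-1) 0 idSymb = f)
    (hg : transfer ((1 - p : ℝ) : ℂ) 1 1 1 g + transfer ((1 - p : ℝ) : ℂ) 1 (-1) 0 f
      - (((v : ℂ) - 1) / 2) • idSymb = g) :
    ∃ C : ℝ, 0 ≤ C ∧ ∀ k : ℝ, |k| ≤ 1 → ∀ t : ℕ,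
      ‖charTilde p k t - ((Real.exp (-(v / 2) * k ^ 2) : ℝ) : ℂ) ^ t‖ ≤
        C * (|k| + t * |k| ^ 3) := by
  set q : ℂ := ((1 - p : ℝ) : ℂ) with hq
  have hq1 : ‖q‖ ≤ 1 := by
    rw [hq, Complex.norm_real, Real.norm_eq_abs, abs_le]
    constructor <;> linarith
  set N : Symb → ℝ := fun h => (energy h).toReal + 1 with hN
  have hN0 (h : Symb) : 0 ≤ N h := by positivity
  set M := (1 + v + v ^ 2) * ∑ i, N (residualSymb q f g i) with hM
  have hM0 : 0 ≤ M := mul_nonneg (by positivity) (Finset.sum_nonneg fun i _ => hN0 _)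
  refine ⟨M + 2 * (N f + N g), by linarith [hN0 f, hN0 g], fun k hk t => ?_⟩
  set lam : ℂ := ((Real.exp (-(v / 2) * k ^ 2) : ℝ) : ℂ) with hlam
  have hlam1 : ‖lam‖ ≤ 1 := by
    rw [hlam, Complex.norm_real, Real.norm_eq_abs, Real.abs_exp, Real.exp_le_one_iff]
    nlinarith [mul_nonneg hv (sq_nonneg k)]
  set V := transferAt q k with hV
  set F := approxEigen k f g with hF
  have hres (t : ℕ) : ‖(V ^ t) (∑ i, residualCoeff v k i • residualSymb q f g i) 0 0 0‖ ≤
      M * |k| ^ 3 := by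
    rw [map_sum, Finset.sum_apply, Finset.sum_apply, Finset.sum_apply, hM, Finset.mul_sum,
      Finset.sum_mul]
    refine (norm_sum_le _ _).trans (Finset.sum_le_sum fun i _ => ?_)
    rw [map_smul, Pi.smul_apply, Pi.smul_apply, Pi.smul_apply, norm_smul, mul_right_comm]
    exact mul_le_mul (norm_residualCoeff_le hv hk i)
      (norm_transferAt_pow_le hq1 (energy_residualSymb_ne_top hq1 hfe hge i) k t)
      (norm_nonneg _) (by positivity)
  have hiter (t : ℕ) : ‖(V ^ t) F 0 0 0 - lam ^ t * F 0 0 0‖ ≤ t * (M * |k| ^ 3) := by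
    induction t with
    | zero => simp
    | succ t ih =>
      have hstep : (V ^ (t + 1)) F 0 0 0 - lam ^ (t + 1) * F 0 0 0
          = lam * ((V ^ t) F 0 0 0 - lam ^ t * F 0 0 0)
            + (V ^ t) (∑ i, residualCoeff v k i • residualSymb q f g i) 0 0 0 := by
        rw [pow_succ, Module.End.mul_apply, hV, hF, transferAt_approxEigen hf hg, map_add,
          map_smul]
        simp only [Pi.add_apply, Pi.smul_apply, smul_eq_mul]
        ring
      rw [hstep]
      refine (norm_add_le _ _).trans ?_
      rw [norm_mul]
      have := mul_le_of_le_one_left (norm_nonneg ((V ^ t) F 0 0 0 - lam ^ t * F 0 0 0)) hlam1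
      push_cast
      linarith [hres t]
  have hchar : charTilde p k t = (V ^ t) idSymb 0 0 0 := (hasSum_char p hp0 hp1 k t).tsum_eq
  have hpow : ‖lam ^ t‖ ≤ 1 := by
    rw [norm_pow]
    exact pow_le_one₀ (norm_nonneg _) hlam1
  have hcorr (h : Symb) (hh : energy h ≠ ⊤) : ‖lam ^ t * h 0 0 0 - (V ^ t) h 0 0 0‖ ≤ 2 * N h := by
    have h0 : ‖h 0 0 0‖ ≤ N h := norm_apply_le_of_energy_le hh le_rfl
    have h1 : ‖(V ^ t) h 0 0 0‖ ≤ N h := norm_transferAt_pow_le hq1 hh k t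
    refine (norm_sub_le _ _).trans ?_
    rw [norm_mul]
    have := mul_le_of_le_one_left (norm_nonneg (h 0 0 0)) hpow
    linarith
  have hsplit : charTilde p k t - lam ^ t = ((V ^ t) F 0 0 0 - lam ^ t * F 0 0 0)
      + (Complex.I * k * (lam ^ t * f 0 0 0 - (V ^ t) f 0 0 0)
        - (k : ℂ) ^ 2 * (lam ^ t * g 0 0 0 - (V ^ t) g 0 0 0)) := by
    rw [hchar, hF, approxEigen, map_sub, map_add, map_smul, map_smul]
    simp only [Pi.add_apply, Pi.sub_apply, Pi.smul_apply, smul_eq_mul]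
    rw [show idSymb 0 0 0 = 1 by simp [idSymb]]
    ring
  have hf2 : ‖Complex.I * k * (lam ^ t * f 0 0 0 - (V ^ t) f 0 0 0)‖ ≤ |k| * (2 * N f) := by
    rw [norm_mul, norm_mul, Complex.norm_I, one_mul, Complex.norm_real, Real.norm_eq_abs]
    exact mul_le_mul_of_nonneg_left (hcorr f hfe) (abs_nonneg k)
  have hg2 : ‖(k : ℂ) ^ 2 * (lam ^ t * g 0 0 0 - (V ^ t) g 0 0 0)‖ ≤ |k| * (2 * N g) := by
    rw [norm_mul, norm_pow, Complex.norm_real, Real.norm_eq_abs]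
    exact mul_le_mul (pow_le_of_le_one (abs_nonneg k) hk two_ne_zero) (hcorr g hge)
      (norm_nonneg _) (abs_nonneg k)
  rw [hsplit]
  have htri := (norm_add_le ((V ^ t) F 0 0 0 - lam ^ t * F 0 0 0)
    (Complex.I * k * (lam ^ t * f 0 0 0 - (V ^ t) f 0 0 0)
        - (k : ℂ) ^ 2 * (lam ^ t * g 0 0 0 - (V ^ t) g 0 0 0))).trans
    (add_le_add (hiter t) ((norm_sub_le _ _).trans (add_le_add hf2 hg2)))
  have e1 : 0 ≤ M * |k| := by positivity
  have e2 : 0 ≤ (N f + N g) * (t * |k| ^ 3) :=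
    mul_nonneg (add_nonneg (hN0 f) (hN0 g)) (by positivity)
  linarith

lemma norm_charTilde_le_one (p : ℝ) (hp0 : 0 ≤ p) (hp1 : p ≤ 1) (k : ℝ) (t : ℕ) :
    ‖charTilde p k t‖ ≤ 1 := by
  have h := hasSum_Ptilde_one p hp0 hp1 t
  refine tsum_of_norm_bounded h fun x => ?_
  rw [norm_mul, Complex.norm_real, Real.norm_eq_abs,
    abs_of_nonneg (Ptilde_nonneg p x t),
    show Complex.I * (k : ℂ) * x = ((k * x : ℝ) : ℂ) * Complex.I by push_cast; ring,
    Complex.norm_exp_ofReal_mul_I, mul_one]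

/-- The characteristic function of the centred and rescaled walk converges with rate `t^{-1/2}`. -/
lemma exists_norm_centered_charTilde_sub_le (p : ℝ) (hp0 : 0 < p) (hp1 : p ≤ 1) (v : ℝ)
    (hv : v = (p + 2 * Real.sqrt (1 + (1 - p) ^ 2) - 2) / p) (k : ℝ) :
    ∃ C > (0 : ℝ), ∃ T : ℕ, ∀ t : ℕ, T ≤ t →
      ‖Complex.exp (-Complex.I * (tildeMean p t : ℂ) * (k : ℂ) / (Real.sqrt t : ℂ))
            * charTilde p (k / Real.sqrt t) t
          - ((Real.exp (-(v / 2) * k ^ 2) : ℝ) : ℂ)‖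
        ≤ C / Real.sqrt t := by
  obtain ⟨a, b, l, hl, h1, h2, h3, h4⟩ := exists_params (q := 1 - p) (by linarith) (by linarith)
  rw [sub_sub_cancel, ← hv] at h4
  have hl' : ‖(l : ℂ)‖ < 1 := by rwa [Complex.norm_real, Real.norm_eq_abs]
  set q : ℂ := ((1 - p : ℝ) : ℂ) with hq
  have hq0 : (1 : ℂ) - q ≠ 0 := by
    rw [hq, ← Complex.ofReal_one, ← Complex.ofReal_sub, Complex.ofReal_ne_zero, sub_sub_cancel]
    exact hp0.ne'
  have hfe := energy_corrOne_ne_top q a b hl'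
  have hge := energy_corrTwo_ne_top q a b hl'
  have hf : transfer q 1 1 1 (corrOne q a b l) + transfer q 1 (-1) 0 idSymb = corrOne q a b l :=
    corrOne_cell (by rw [hq]; exact_mod_cast h1) (by rw [hq]; exact_mod_cast h2)
      (by rw [hq]; exact_mod_cast h3)
  have hg := corrTwo_cell (a := a) (b := b) (l := l) hq0
  have hqb : q * b = ((v : ℂ) - 1) / 2 := by
    rw [← h4, hq]; push_cast; ring
  rw [hqb] at hg
  obtain ⟨C, hC0, hC⟩ :=
    exists_norm_charTilde_sub_le p hp0.le hp1 (nonneg_variance hp0 hv) hfe hge hf hg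
  set B := 2 * ((energy (corrOne q a b l)).toReal + 1) with hB
  have hB0 : 0 ≤ B := by positivity
  obtain ⟨T, hT⟩ := exists_nat_ge (k ^ 2)
  refine ⟨B * |k| + C * (|k| + |k| ^ 3) + 1, by positivity, T + 1, fun t ht => ?_⟩
  have ht0 : (0 : ℝ) < t := by exact_mod_cast (by omega : 0 < t)
  have hTt : (T : ℝ) ≤ t := by exact_mod_cast (by omega : T ≤ t)
  set s := Real.sqrt t with hs
  have hs0 : 0 < s := Real.sqrt_pos.2 ht0
  have hs2 : s ^ 2 = t := Real.sq_sqrt ht0.le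
  have hks : |k / s| ≤ 1 := by
    rw [abs_div, abs_of_pos hs0, div_le_one hs0]
    exact abs_le_of_sq_le_sq (by linarith) hs0.le
  have hchar := hC (k / s) hks t
  have hpow : ((Real.exp (-(v / 2) * (k / s) ^ 2) : ℝ) : ℂ) ^ t
      = ((Real.exp (-(v / 2) * k ^ 2) : ℝ) : ℂ) := by
    rw [← Complex.ofReal_pow, ← Real.exp_nat_mul, div_pow, hs2]
    congr 2
    field_simp
  have hbound : |k / s| + t * |k / s| ^ 3 = (|k| + |k| ^ 3) / s := by
    rw [abs_div, abs_of_pos hs0, ← hs2]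
    field_simp
  rw [hpow, hbound] at hchar
  have hphase : ‖Complex.exp (-Complex.I * (tildeMean p t : ℂ) * (k : ℂ) / (s : ℂ)) - 1‖
      ≤ B * |k| / s := by
    rw [show -Complex.I * (tildeMean p t : ℂ) * (k : ℂ) / (s : ℂ)
      = Complex.I * ((-(tildeMean p t * k / s) : ℝ) : ℂ) by push_cast; ring]
    refine (Real.norm_exp_I_mul_ofReal_sub_one_le).trans ?_
    rw [norm_neg, Real.norm_eq_abs, abs_div, abs_mul, abs_of_pos hs0]
    gcongr
    exact abs_tildeMean_le p hp0.le hp1 hfe hf t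
  have hone := norm_charTilde_le_one p hp0.le hp1 (k / s) t
  generalize Complex.exp (-Complex.I * (tildeMean p t : ℂ) * (k : ℂ) / (s : ℂ)) = z at hphase ⊢
  generalize charTilde p (k / s) t = w at hchar hone ⊢
  generalize ((Real.exp (-(v / 2) * k ^ 2) : ℝ) : ℂ) = y at hchar ⊢
  calc ‖z * w - y‖ = ‖(z - 1) * w + (w - y)‖ := by ring_nf
    _ ≤ B * |k| / s + C * ((|k| + |k| ^ 3) / s) := by
      refine (norm_add_le _ _).trans (add_le_add ?_ hchar)
      rw [norm_mul]
      exact (mul_le_of_le_one_right (norm_nonneg _) hone).trans hphase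
    _ ≤ (B * |k| + C * (|k| + |k| ^ 3) + 1) / s := by
      rw [← mul_div_assoc, ← add_div]
      exact div_le_div_of_nonneg_right (by linarith) hs0.le

/-- The law of the walk started at `|0,1⟩` after `t` steps. -/
def walkLaw (p : ℝ) (hp0 : 0 ≤ p) (hp1 : p ≤ 1) (t : ℕ) : PMF ℤ :=
  ⟨fun x => ENNReal.ofReal (Ptilde p x t), by
    have h := hasSum_Ptilde_one p hp0 hp1 t
    have h' := ENNReal.summable.hasSum (f := fun x : ℤ => ENNReal.ofReal (Ptilde p x t))
    rwa [← ENNReal.ofReal_tsum_of_nonneg (fun x => Ptilde_nonneg p x t) h.summable, h.tsum_eq,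
      ENNReal.ofReal_one] at h'⟩

/-- The law of the centred and rescaled walk. -/
def rescaledLaw (p : ℝ) (hp0 : 0 ≤ p) (hp1 : p ≤ 1) (t : ℕ) :
    MeasureTheory.ProbabilityMeasure ℝ :=
  ⟨(walkLaw p hp0 hp1 t).toMeasure.map fun x : ℤ => ((x : ℝ) - tildeMean p t) / Real.sqrt t,
    MeasureTheory.Measure.isProbabilityMeasure_map (measurable_of_countable _).aemeasurable⟩

lemma integral_rescaledLaw {E : Type*} [NormedAddCommGroup E] [NormedSpace ℝ E] [CompleteSpace E]
    (p : ℝ) (hp0 : 0 ≤ p) (hp1 : p ≤ 1) (t : ℕ) {f : ℝ → E} (hf : Continuous f) {c : ℝ}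
    (hc : ∀ y, ‖f y‖ ≤ c) :
    ∫ y, f y ∂(rescaledLaw p hp0 hp1 t : MeasureTheory.Measure ℝ)
      = ∑' x : ℤ, Ptilde p x t • f (((x : ℝ) - tildeMean p t) / Real.sqrt t) := by
  rw [rescaledLaw, MeasureTheory.ProbabilityMeasure.coe_mk,
    MeasureTheory.integral_map (measurable_of_countable _).aemeasurable
      hf.aestronglyMeasurable, PMF.integral_eq_tsum]
  · exact tsum_congr fun x => by
      congr 1
      exact ENNReal.toReal_ofReal (Ptilde_nonneg p x t)
  · exact MeasureTheory.Integrable.of_bound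
      MeasureTheory.StronglyMeasurable.of_discrete.aestronglyMeasurable c (.of_forall fun x => hc _)

lemma charFun_rescaledLaw (p : ℝ) (hp0 : 0 ≤ p) (hp1 : p ≤ 1) (t : ℕ) (k : ℝ) :
    MeasureTheory.charFun (rescaledLaw p hp0 hp1 t : MeasureTheory.Measure ℝ) k
      = Complex.exp (-Complex.I * (tildeMean p t : ℂ) * (k : ℂ) / (Real.sqrt t : ℂ))
        * charTilde p (k / Real.sqrt t) t := by
  rw [MeasureTheory.charFun_apply_real, integral_rescaledLaw p hp0 hp1 t (by fun_prop)
    (c := 1) fun y => by rw [← Complex.ofReal_mul, Complex.norm_exp_ofReal_mul_I], charTilde,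
    ← tsum_mul_left]
  refine tsum_congr fun x => ?_
  rw [Complex.real_smul, mul_left_comm, ← Complex.exp_add]
  congr 2
  push_cast
  ring

/-- CLT for the decoherent Hadamard walk started at `|0,1⟩`: with `μ_t = E(X̃_t)` and
`v = (p + 2√(1+q²) - 2)/p`, for every fixed `k`,
`e^{-iμ_t k/√t}·P̃̂(k/√t, t) = exp(-(v/2)k²) + O(t^{-1/2})`, and consequently
`(X̃_t - μ_t)/√t` converges in distribution to `N(0, v)`. -/
theorem tilde_walk_clt (p q : ℝ) (hp0 : 0 < p) (hp1 : p ≤ 1) (hq : q = 1 - p)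
    (v : ℝ) (hv : v = (p + 2 * Real.sqrt (1 + q ^ 2) - 2) / p) :
    (∀ k : ℝ, ∃ C > (0 : ℝ), ∃ T : ℕ, ∀ t : ℕ, T ≤ t →
      ‖Complex.exp (-Complex.I * (tildeMean p t : ℂ) * (k : ℂ) / (Real.sqrt t : ℂ))
            * charTilde p (k / Real.sqrt t) t
          - ((Real.exp (-(v / 2) * k ^ 2) : ℝ) : ℂ)‖
        ≤ C / Real.sqrt t) ∧
    (∀ f : BoundedContinuousFunction ℝ ℝ,
      Tendsto
        (fun t : ℕ => ∑' x : ℤ, Ptilde p x t * f (((x : ℝ) - tildeMean p t) / Real.sqrt t))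
        atTop
        (nhds (∫ y, f y ∂(ProbabilityTheory.gaussianReal 0 (Real.toNNReal v))))) := by
  subst hq
  have hchar := exists_norm_centered_charTilde_sub_le p hp0 hp1 v hv
  refine ⟨hchar, fun f => ?_⟩
  have hlim : Tendsto (fun t => rescaledLaw p hp0.le hp1 t) atTop
      (nhds ⟨ProbabilityTheory.gaussianReal 0 (Real.toNNReal v), inferInstance⟩) := by
    refine MeasureTheory.ProbabilityMeasure.tendsto_of_tendsto_charFun fun k => ?_
    obtain ⟨C, -, T, hT⟩ := hchar k
    rw [MeasureTheory.ProbabilityMeasure.coe_mk, ProbabilityTheory.charFun_gaussianReal,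
      Real.coe_toNNReal v (nonneg_variance hp0 hv),
      show Complex.exp (k * ((0 : ℝ) : ℂ) * Complex.I - v * k ^ 2 / 2)
        = ((Real.exp (-(v / 2) * k ^ 2) : ℝ) : ℂ) by push_cast; congr 1; ring,
      tendsto_iff_norm_sub_tendsto_zero]
    have h0 : Tendsto (fun t : ℕ => C / Real.sqrt t) atTop (nhds 0) :=
      (Real.tendsto_sqrt_atTop.comp tendsto_natCast_atTop_atTop).const_div_atTop C
    refine squeeze_zero' (.of_forall fun t => norm_nonneg _) ?_ h0
    filter_upwards [eventually_ge_atTop T] with t ht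
    rw [charFun_rescaledLaw]
    exact hT t ht
  have h := MeasureTheory.ProbabilityMeasure.tendsto_iff_forall_integral_tendsto.1 hlim f
  simpa only [integral_rescaledLaw p hp0.le hp1 _ f.continuous f.norm_coe_le_norm, smul_eq_mul,
    MeasureTheory.ProbabilityMeasure.coe_mk] using h

end
end

section
/- Let Q_t denote the pure (undecohered) symmetric Hadamard walk on the line. Then the long-term variance satisfies Var(Q_t)/t² → 1 − 1/√2 as t → ∞. -/
noncomputable section

open Complex Filter

/-- The Fourier series `k ↦ ∑ₓ c(x) e^{ikx}`. -/
def trigSum (c : ℤ → ℂ) (k : ℝ) : ℂ := ∑' x : ℤ, c x * Complex.exp (x * (k * I))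

theorem trigSum_eq_sum {c : ℤ → ℂ} {s : Finset ℤ} (hs : Function.support c ⊆ s) (k : ℝ) :
    trigSum c k = ∑ x ∈ s, c x * Complex.exp (x * (k * I)) :=
  tsum_eq_sum fun x hx => by
    rw [Function.notMem_support.mp fun h => hx (hs h), zero_mul]

theorem summable_trigSum {c : ℤ → ℂ} (hc : (Function.support c).Finite) (k : ℝ) :
    Summable fun x : ℤ => c x * Complex.exp (x * (k * I)) :=
  summable_of_hasFiniteSupport (hc.subset (Function.support_mul_subset_left _ _))

theorem trigSum_add {c d : ℤ → ℂ} (hc : (Function.support c).Finite)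
    (hd : (Function.support d).Finite) (k : ℝ) :
    trigSum (fun x => c x + d x) k = trigSum c k + trigSum d k := by
  simp only [trigSum, add_mul]
  exact (summable_trigSum hc k).tsum_add (summable_trigSum hd k)

theorem trigSum_mul_left (a : ℂ) (c : ℤ → ℂ) (k : ℝ) :
    trigSum (fun x => a * c x) k = a * trigSum c k := by
  simp only [trigSum, mul_assoc, tsum_mul_left]

theorem trigSum_comp_add (c : ℤ → ℂ) (a : ℤ) (k : ℝ) :
    trigSum (fun x => c (x + a)) k = Complex.exp (-(a * (k * I))) * trigSum c k := by
  rw [trigSum, trigSum, ← tsum_mul_left,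
    ← (Equiv.addRight a).tsum_eq fun x : ℤ =>
      Complex.exp (-(a * (k * I))) * (c x * Complex.exp (x * (k * I)))]
  refine tsum_congr fun x => ?_
  have hexp : Complex.exp (x * (k * I)) =
      Complex.exp (-(a * (k * I))) * Complex.exp ((x + a : ℤ) * (k * I)) := by
    rw [← Complex.exp_add]
    congr 1
    push_cast
    ring
  rw [hexp, Equiv.coe_addRight]
  ring

theorem continuous_trigSum {c : ℤ → ℂ} (hc : (Function.support c).Finite) :
    Continuous (trigSum c) := by
  have h : trigSum c = fun k : ℝ => ∑ x ∈ hc.toFinset, c x * Complex.exp (x * (k * I)) :=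
    funext (trigSum_eq_sum (by simp))
  rw [h]
  fun_prop

theorem integral_exp_int_mul_I (n : ℤ) :
    ∫ k in (0 : ℝ)..2 * Real.pi, Complex.exp (n * (k * I)) =
      if n = 0 then ((2 * Real.pi : ℝ) : ℂ) else 0 := by
  split_ifs with h
  · simp [h]
  · have hn : (n : ℂ) * I ≠ 0 := mul_ne_zero (Int.cast_ne_zero.mpr h) I_ne_zero
    have hperiod : Complex.exp (n * I * ((2 * Real.pi : ℝ) : ℂ)) = 1 := by
      rw [Complex.exp_eq_one_iff]
      exact ⟨n, by push_cast; ring⟩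
    calc ∫ k in (0 : ℝ)..2 * Real.pi, Complex.exp (n * (k * I))
        = ∫ k in (0 : ℝ)..2 * Real.pi, Complex.exp (n * I * k) := by
          refine intervalIntegral.integral_congr fun k _ => ?_
          ring_nf
      _ = 0 := by
          rw [integral_exp_mul_complex hn, hperiod]
          simp

/-- Parseval's identity for trigonometric polynomials. -/
theorem integral_norm_sq_trigSum {c : ℤ → ℂ} (hc : (Function.support c).Finite) :
    ∫ k in (0 : ℝ)..2 * Real.pi, ‖trigSum c k‖ ^ 2 = 2 * Real.pi * ∑' x, ‖c x‖ ^ 2 := by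
  set s := hc.toFinset
  have hs : Function.support c ⊆ s := by simp [s]
  have hsum : ∑' x, ‖c x‖ ^ 2 = ∑ x ∈ s, ‖c x‖ ^ 2 := tsum_eq_sum fun x hx => by
    rw [Function.notMem_support.mp fun h => hx (hs h)]
    simp
  have hpoint (k : ℝ) : ((‖trigSum c k‖ ^ 2 : ℝ) : ℂ) = ∑ x ∈ s, ∑ y ∈ s,
      c x * (starRingEnd ℂ) (c y) * Complex.exp (((x - y : ℤ) : ℂ) * (k * I)) := by
    rw [Complex.ofReal_pow, ← Complex.mul_conj', trigSum_eq_sum hs, map_sum, Finset.sum_mul_sum]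
    refine Finset.sum_congr rfl fun x _ => Finset.sum_congr rfl fun y _ => ?_
    have hexp : Complex.exp (((x - y : ℤ) : ℂ) * (k * I)) =
        Complex.exp (x * (k * I)) * (starRingEnd ℂ) (Complex.exp (y * (k * I))) := by
      rw [← Complex.exp_conj, ← Complex.exp_add]
      congr 1
      simp
      ring
    rw [hexp, map_mul]
    ring
  apply Complex.ofReal_injective
  rw [← intervalIntegral.integral_ofReal]
  simp only [hpoint]
  rw [intervalIntegral.integral_finsetSum fun x _ =>
    Continuous.intervalIntegrable (by fun_prop) _ _]
  have hinner (x : ℤ) (hx : x ∈ s) : ∫ k in (0 : ℝ)..2 * Real.pi, ∑ y ∈ s,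
      c x * (starRingEnd ℂ) (c y) * Complex.exp (((x - y : ℤ) : ℂ) * (k * I)) =
        (‖c x‖ : ℂ) ^ 2 * ((2 * Real.pi : ℝ) : ℂ) := by
    rw [intervalIntegral.integral_finsetSum fun y _ =>
      Continuous.intervalIntegrable (by fun_prop) _ _]
    simp only [intervalIntegral.integral_const_mul, integral_exp_int_mul_I, sub_eq_zero]
    simp [hx, Complex.mul_conj']
  rw [Finset.sum_congr rfl hinner, hsum, ← Finset.sum_mul]
  push_cast
  ring

theorem integral_cos_sq_div_one_add_cos_sq :
    ∫ k in (0 : ℝ)..2 * Real.pi, Real.cos k ^ 2 / (1 + Real.cos k ^ 2) =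
      2 * Real.pi * (1 - 1 / √2) := by
  have h2 : √2 ^ 2 = (2 : ℝ) := Real.sq_sqrt zero_le_two
  have hpos : 0 < √(2 : ℝ) := by positivity
  have hderiv (k : ℝ) : HasDerivAt (fun k : ℝ => k - (k / √2 - 1 / √2 *
      Real.arctan (Real.sin (2 * k) / (3 + 2 * √2 + Real.cos (2 * k)))))
      (Real.cos k ^ 2 / (1 + Real.cos k ^ 2)) k := by
    have hden : 0 < 3 + 2 * √2 + Real.cos (2 * k) := by
      linarith [Real.neg_one_le_cos (2 * k)]
    have hlin : HasDerivAt (fun k : ℝ => 2 * k) 2 k := by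
      simpa using (hasDerivAt_id k).const_mul 2
    have hquot := ((hlin.sin.div (hlin.cos.const_add (3 + 2 * √2)) hden.ne').arctan.const_mul
      (1 / √2))
    refine ((hasDerivAt_id k).sub (((hasDerivAt_id k).div_const √2).sub hquot)).congr_deriv ?_
    have hs := Real.sin_sq (2 * k)
    have hc : Real.cos k ^ 2 = (1 + Real.cos (2 * k)) / 2 := by rw [Real.cos_sq]; ring
    have hcos := Real.neg_one_le_cos (2 * k)
    rw [hc]
    simp only [Pi.div_apply]
    generalize Real.cos (2 * k) = c at *
    generalize Real.sin (2 * k) = s at *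
    generalize √(2 : ℝ) = r at *
    have h3 : 0 < 3 + c := by linarith
    have hcomb : (3 + 2 * r + c) ^ 2 + s ^ 2 = (6 + 4 * r) * (3 + c) := by
      linear_combination hs + 4 * h2
    have harctan : 1 / (1 + (s / (3 + 2 * r + c)) ^ 2) *
        ((c * 2 * (3 + 2 * r + c) - s * (-s * 2)) / (3 + 2 * r + c) ^ 2) =
          (2 * c * (3 + 2 * r) + 2) / ((6 + 4 * r) * (3 + c)) := by
      have hnum : c * 2 * (3 + 2 * r + c) - s * (-s * 2) = 2 * c * (3 + 2 * r) + 2 := by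
        linear_combination 2 * hs
      rw [hnum, ← hcomb]
      field_simp
    rw [harctan]
    have h1 : 1 + (1 + c) / 2 = (3 + c) / 2 := by ring
    rw [h1]
    field_simp
    linear_combination 8 * h2
  rw [intervalIntegral.integral_eq_sub_of_hasDerivAt (fun k _ => hderiv k)]
  · have : Real.sin (2 * (2 * Real.pi)) = 0 := by
      rw [← mul_assoc]
      exact_mod_cast Real.sin_nat_mul_pi (2 * 2)
    simp [this]
    ring
  · refine Continuous.intervalIntegrable (Continuous.div (by fun_prop) (by fun_prop)
      fun k => ?_) _ _
    positivity

/-- The position operator. -/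
def position (ψ : QState) : QState := fun v => v.1 * ψ v

/-- The momentum representation of a state. -/
def momentum (ψ : QState) (k : ℝ) : ℂ × ℂ :=
  (trigSum (fun x => ψ (x, 0)) k, trigSum (fun x => ψ (x, 1)) k)

/-- The Pauli `Z` operator on the coin space. -/
def pauliZ (v : ℂ × ℂ) : ℂ × ℂ := (v.1, -v.2)

/-- One step of the Hadamard walk at fixed momentum `k`. -/
def momentumStep (k : ℝ) : ℂ × ℂ →ₗ[ℂ] ℂ × ℂ where
  toFun v := (Complex.exp (k * I) * ((v.1 + v.2) / (Real.sqrt 2 : ℂ)),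
    Complex.exp (-(k * I)) * ((v.1 - v.2) / (Real.sqrt 2 : ℂ)))
  map_add' v w := by ext <;> simp <;> ring
  map_smul' a v := by ext <;> simp <;> ring

/-- The group velocity operator at momentum `k`: the component of `pauliZ` commuting with
`momentumStep k`. -/
def velocity (k : ℝ) (v : ℂ × ℂ) : ℂ × ℂ :=
  (Real.cos k * (Real.cos k * v.1 + Complex.exp (k * I) * v.2) / (1 + (Real.cos k : ℂ) ^ 2),
    Real.cos k * (Complex.exp (-(k * I)) * v.1 - Real.cos k * v.2) / (1 + (Real.cos k : ℂ) ^ 2))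

/-- A solution `B` of the cohomological equation `B - U B U⁻¹ = Z - V`, where `U`, `Z` and `V`
are `momentumStep k`, `pauliZ` and `velocity k`. -/
def corrector (k : ℝ) (v : ℂ × ℂ) : ℂ × ℂ :=
  ((v.1 - v.2) / (2 * (1 + (Real.cos k : ℂ) ^ 2)),
    (-v.1 - v.2) / (2 * (1 + (Real.cos k : ℂ) ^ 2)))

theorem exp_mul_I_mul_exp_neg (k : ℝ) :
    Complex.exp (k * I) * Complex.exp (-(k * I)) = 1 := by
  rw [← Complex.exp_add, add_neg_cancel, Complex.exp_zero]

theorem exp_mul_I_add_exp_neg (k : ℝ) :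
    Complex.exp (k * I) + Complex.exp (-(k * I)) = 2 * Real.cos k := by
  rw [Complex.ofReal_cos, Complex.two_cos, neg_mul]

theorem one_add_cos_sq_ne_zero (k : ℝ) : 1 + (Real.cos k : ℂ) ^ 2 ≠ 0 := by
  have h : (1 + Real.cos k ^ 2 : ℝ) ≠ 0 := by positivity
  exact_mod_cast h

theorem momentumStep_velocity (k : ℝ) (v : ℂ × ℂ) :
    momentumStep k (velocity k v) = velocity k (momentumStep k v) := by
  have h1 := exp_mul_I_mul_exp_neg k
  have h2 := exp_mul_I_add_exp_neg k
  ext <;> simp only [momentumStep, velocity, LinearMap.coe_mk, AddHom.coe_mk] <;>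
    generalize Complex.exp (k * I) = e at * <;>
    generalize Complex.exp (-(k * I)) = f at * <;>
    generalize (Real.cos k : ℂ) = c at * <;>
    simp only [div_eq_mul_inv] <;>
    grind

theorem pauliZ_momentumStep (k : ℝ) (v : ℂ × ℂ) :
    pauliZ (momentumStep k v) = velocity k (momentumStep k v) +
      corrector k (momentumStep k v) - momentumStep k (corrector k v) := by
  have h1 := exp_mul_I_mul_exp_neg k
  have h2 := exp_mul_I_add_exp_neg k
  have hd := one_add_cos_sq_ne_zero k
  ext <;> simp only [momentumStep, velocity, corrector, pauliZ, LinearMap.coe_mk, AddHom.coe_mk,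
      Prod.fst_add, Prod.snd_add, Prod.fst_sub, Prod.snd_sub] <;>
    generalize Complex.exp (k * I) = e at * <;>
    generalize Complex.exp (-(k * I)) = f at * <;>
    generalize (Real.cos k : ℂ) = c at * <;>
    simp only [div_eq_mul_inv, mul_inv] <;>
    grind

theorem finite_support_hadamardStep {ψ : QState} (hψ : (Function.support ψ).Finite) :
    (Function.support (hadamardStep ψ)).Finite := by
  refine ((hψ.image fun v => (v.1 + 1, (0 : Fin 2))).union
    (hψ.image fun v => (v.1 - 1, (1 : Fin 2)))).subset ?_
  rintro ⟨x, n⟩ hv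
  by_contra hx
  simp only [Set.mem_union, Set.mem_image, not_or, not_exists, not_and] at hx
  apply hv
  fin_cases n
  · have h (m : Fin 2) : ψ (x - 1, m) = 0 := by
      by_contra h
      exact hx.1 _ h (by simp)
    simp [hadamardStep, h]
  · have h (m : Fin 2) : ψ (x + 1, m) = 0 := by
      by_contra h
      exact hx.2 _ h (by simp)
    simp [hadamardStep, h]

theorem finite_support_iterate_hadamardStep (t : ℕ) :
    (Function.support (hadamardStep^[t] phi0)).Finite := by
  induction t with
  | zero =>
    refine (Set.toFinite {((0 : ℤ), (0 : Fin 2)), ((0 : ℤ), (1 : Fin 2))}).subset fun v hv => ?_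
    by_contra h
    simp only [Set.mem_insert_iff, Set.mem_singleton_iff, not_or] at h
    exact hv (by simp [phi0, h])
  | succ t ih =>
    rw [Function.iterate_succ_apply']
    exact finite_support_hadamardStep ih

theorem finite_support_position {ψ : QState} (hψ : (Function.support ψ).Finite) :
    (Function.support (position ψ)).Finite :=
  hψ.subset (Function.support_mul_subset_right _ _)

theorem finite_support_component {ψ : QState} (hψ : (Function.support ψ).Finite) (n : Fin 2) :
    (Function.support fun x : ℤ => ψ (x, n)).Finite :=
  hψ.preimage (Prod.mk_left_injective n).injOn

theorem momentum_hadamardStep {ψ : QState} (hψ : (Function.support ψ).Finite) (k : ℝ) :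
    momentum (hadamardStep ψ) k = momentumStep k (momentum ψ k) := by
  have h0 := finite_support_component hψ 0
  have h1 := finite_support_component hψ 1
  have h1' : (Function.support fun x : ℤ => (-1) * ψ (x, 1)).Finite :=
    h1.subset (Function.support_mul_subset_right _ _)
  ext
  · have h (x : ℤ) : hadamardStep ψ (x, 0) =
        (Real.sqrt 2 : ℂ)⁻¹ * (ψ (x + -1, 0) + ψ (x + -1, 1)) := by
      simp [hadamardStep, div_eq_inv_mul, sub_eq_add_neg]
    simp only [momentum, momentumStep, LinearMap.coe_mk, AddHom.coe_mk, h]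
    rw [trigSum_mul_left, trigSum_comp_add (fun x => ψ (x, 0) + ψ (x, 1)), trigSum_add h0 h1]
    simp only [Int.cast_neg, Int.cast_one, neg_mul, one_mul, neg_neg]
    ring
  · have h (x : ℤ) : hadamardStep ψ (x, 1) =
        (Real.sqrt 2 : ℂ)⁻¹ * (ψ (x + 1, 0) + (-1) * ψ (x + 1, 1)) := by
      simp [hadamardStep, div_eq_inv_mul, sub_eq_add_neg]
    simp only [momentum, momentumStep, LinearMap.coe_mk, AddHom.coe_mk, h]
    rw [trigSum_mul_left, trigSum_comp_add (fun x => ψ (x, 0) + (-1) * ψ (x, 1)),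
      trigSum_add h0 h1', trigSum_mul_left]
    simp only [Int.cast_one, one_mul]
    ring

theorem momentum_position_hadamardStep {ψ : QState} (hψ : (Function.support ψ).Finite) (k : ℝ) :
    momentum (position (hadamardStep ψ)) k =
      momentumStep k (momentum (position ψ) k) + pauliZ (momentumStep k (momentum ψ k)) := by
  have hU := finite_support_hadamardStep hψ
  have hX := finite_support_hadamardStep (finite_support_position hψ)
  rw [← momentum_hadamardStep hψ, ← momentum_hadamardStep (finite_support_position hψ)]
  have h1' : (Function.support fun x : ℤ => (-1) * hadamardStep ψ (x, 1)).Finite :=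
    (finite_support_component hU 1).subset (Function.support_mul_subset_right _ _)
  ext
  · have h (x : ℤ) : position (hadamardStep ψ) (x, 0) =
        hadamardStep (position ψ) (x, 0) + hadamardStep ψ (x, 0) := by
      simp [hadamardStep, position]
      ring
    simp only [momentum, pauliZ, Prod.fst_add, h]
    rw [trigSum_add (finite_support_component hX 0) (finite_support_component hU 0)]
  · have h (x : ℤ) : position (hadamardStep ψ) (x, 1) =
        hadamardStep (position ψ) (x, 1) + (-1) * hadamardStep ψ (x, 1) := by
      simp [hadamardStep, position]
      ring
    simp only [momentum, pauliZ, Prod.snd_add, h]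
    rw [trigSum_add (finite_support_component hX 1) h1', trigSum_mul_left, neg_one_mul]

theorem momentum_iterate_hadamardStep (t : ℕ) (k : ℝ) :
    momentum (hadamardStep^[t] phi0) k = (momentumStep k)^[t] (momentum phi0 k) := by
  induction t with
  | zero => rfl
  | succ t ih =>
    rw [Function.iterate_succ_apply', Function.iterate_succ_apply',
      momentum_hadamardStep (finite_support_iterate_hadamardStep t), ih]

theorem position_phi0 : position phi0 = 0 := by
  ext ⟨x, n⟩
  by_cases hx : x = 0 <;> simp [position, phi0, hx]

/-- The Heisenberg evolution of the position is ballistic up to bounded terms. -/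
theorem momentum_position_iterate_hadamardStep (t : ℕ) (k : ℝ) :
    momentum (position (hadamardStep^[t] phi0)) k =
      (t : ℂ) • velocity k ((momentumStep k)^[t] (momentum phi0 k)) +
        (corrector k ((momentumStep k)^[t] (momentum phi0 k)) -
          (momentumStep k)^[t] (corrector k (momentum phi0 k))) := by
  induction t with
  | zero => simp [position_phi0, momentum, trigSum]
  | succ t ih =>
    rw [Function.iterate_succ_apply', Function.iterate_succ_apply', Function.iterate_succ_apply',
      momentum_position_hadamardStep (finite_support_iterate_hadamardStep t), ih,
      momentum_iterate_hadamardStep, pauliZ_momentumStep, map_add, map_sub, map_smul,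
      momentumStep_velocity]
    push_cast
    module

theorem norm_exp_mul_I_mul (k : ℝ) (z : ℂ) : ‖Complex.exp (k * I) * z‖ = ‖z‖ := by
  rw [norm_mul, Complex.norm_exp_ofReal_mul_I, one_mul]

theorem norm_exp_neg_mul_I_mul (k : ℝ) (z : ℂ) : ‖Complex.exp (-(k * I)) * z‖ = ‖z‖ := by
  simpa using norm_exp_mul_I_mul (-k) z

theorem norm_sq_momentumStep (k : ℝ) (v : ℂ × ℂ) :
    ‖(momentumStep k v).1‖ ^ 2 + ‖(momentumStep k v).2‖ ^ 2 = ‖v.1‖ ^ 2 + ‖v.2‖ ^ 2 := by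
  simp only [momentumStep, LinearMap.coe_mk, AddHom.coe_mk, norm_exp_mul_I_mul,
    norm_exp_neg_mul_I_mul, norm_div, div_pow, ← add_div]
  rw [parallelogram_law_with_norm ℂ, Complex.norm_real, Real.norm_eq_abs, sq_abs,
    Real.sq_sqrt (by norm_num)]
  ring

theorem norm_sq_iterate_momentumStep (t : ℕ) (k : ℝ) (v : ℂ × ℂ) :
    ‖((momentumStep k)^[t] v).1‖ ^ 2 + ‖((momentumStep k)^[t] v).2‖ ^ 2 =
      ‖v.1‖ ^ 2 + ‖v.2‖ ^ 2 := by
  induction t with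
  | zero => rfl
  | succ t ih => rw [Function.iterate_succ_apply', norm_sq_momentumStep, ih]

theorem norm_one_add_cos_sq (k : ℝ) : ‖1 + (Real.cos k : ℂ) ^ 2‖ = 1 + Real.cos k ^ 2 := by
  have h : (1 : ℂ) + (Real.cos k : ℂ) ^ 2 = ((1 + Real.cos k ^ 2 : ℝ) : ℂ) := by push_cast; rfl
  rw [h, Complex.norm_of_nonneg (by positivity)]

theorem norm_sq_velocity (k : ℝ) (v : ℂ × ℂ) :
    ‖(velocity k v).1‖ ^ 2 + ‖(velocity k v).2‖ ^ 2 =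
      Real.cos k ^ 2 / (1 + Real.cos k ^ 2) * (‖v.1‖ ^ 2 + ‖v.2‖ ^ 2) := by
  have h2 : Complex.exp (-(k * I)) * v.1 - Real.cos k * v.2 =
      Complex.exp (-(k * I)) * (v.1 - Real.cos k * (Complex.exp (k * I) * v.2)) := by
    linear_combination (Real.cos k : ℂ) * v.2 * exp_mul_I_mul_exp_neg k
  have hsum (c : ℝ) (a b : ℂ) : ‖c * a + b‖ ^ 2 + ‖a - c * b‖ ^ 2 =
      (1 + c ^ 2) * (‖a‖ ^ 2 + ‖b‖ ^ 2) := by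
    simp only [Complex.sq_norm, Complex.normSq_apply, Complex.add_re, Complex.add_im,
      Complex.sub_re, Complex.sub_im, Complex.re_ofReal_mul, Complex.im_ofReal_mul]
    ring
  have h := hsum (Real.cos k) v.1 (Complex.exp (k * I) * v.2)
  rw [norm_exp_mul_I_mul] at h
  simp only [velocity, h2, norm_div, norm_mul (Real.cos k : ℂ), norm_exp_neg_mul_I_mul,
    norm_one_add_cos_sq, div_pow, mul_pow, Complex.norm_real, Real.norm_eq_abs, sq_abs]
  rw [← add_div, ← mul_add, h]
  field_simp

theorem norm_corrector_le {v : ℂ × ℂ} (k : ℝ) (h1 : ‖v.1‖ ≤ 1) (h2 : ‖v.2‖ ≤ 1) :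
    ‖(corrector k v).1‖ ≤ 1 ∧ ‖(corrector k v).2‖ ≤ 1 := by
  have hd : 0 < 2 * (1 + Real.cos k ^ 2) := by positivity
  simp only [corrector, norm_div, norm_mul, norm_one_add_cos_sq, Complex.norm_ofNat,
    div_le_one hd]
  constructor
  · nlinarith [norm_sub_le v.1 v.2, sq_nonneg (Real.cos k)]
  · nlinarith [norm_sub_le (-v.1) v.2, norm_neg v.1, sq_nonneg (Real.cos k)]

theorem norm_sq_corrector_le (k : ℝ) (v : ℂ × ℂ) :
    ‖(corrector k v).1‖ ^ 2 + ‖(corrector k v).2‖ ^ 2 ≤ ‖v.1‖ ^ 2 + ‖v.2‖ ^ 2 := by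
  have hd : (1 : ℝ) ≤ (1 + Real.cos k ^ 2) ^ 2 := by nlinarith [sq_nonneg (Real.cos k)]
  have h := parallelogram_law_with_norm ℂ v.1 v.2
  have hneg : ‖-v.1 - v.2‖ = ‖v.1 + v.2‖ := by rw [← norm_neg]; congr 1; ring
  simp only [corrector, norm_div, norm_mul, norm_one_add_cos_sq, Complex.norm_ofNat, hneg,
    div_pow, ← add_div]
  rw [div_le_iff₀ (by positivity)]
  nlinarith [sq_nonneg ‖v.1‖, sq_nonneg ‖v.2‖]

theorem norm_sq_momentum_phi0 (k : ℝ) :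
    ‖(momentum phi0 k).1‖ ^ 2 + ‖(momentum phi0 k).2‖ ^ 2 = 1 := by
  have h (n : Fin 2) : trigSum (fun x => phi0 (x, n)) k = phi0 (0, n) := by
    rw [trigSum_eq_sum (s := {0})]
    · simp
    · intro x hx
      by_contra h
      simp only [Finset.coe_singleton, Set.mem_singleton_iff] at h
      exact hx (by simp [phi0, h])
  simp only [momentum, h]
  norm_num [phi0]

theorem abs_norm_add_sq_sub_le (a b : ℂ) :
    |‖a + b‖ ^ 2 - ‖a‖ ^ 2| ≤ ‖b‖ * (2 * ‖a‖ + ‖b‖) := by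
  rw [sq_sub_sq, abs_mul, mul_comm]
  refine mul_le_mul ?_ ?_ (abs_nonneg _) (norm_nonneg _)
  · simpa using abs_norm_sub_norm_le (a + b) a
  · rw [abs_of_nonneg (by positivity)]
    linarith [norm_add_le a b]

theorem abs_norm_sq_momentum_position_sub_le (t : ℕ) (k : ℝ) :
    |‖(momentum (position (hadamardStep^[t] phi0)) k).1‖ ^ 2 +
        ‖(momentum (position (hadamardStep^[t] phi0)) k).2‖ ^ 2 -
      (t : ℝ) ^ 2 * (Real.cos k ^ 2 / (1 + Real.cos k ^ 2))| ≤ 8 * (t : ℝ) + 8 := by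
  rw [momentum_position_iterate_hadamardStep]
  have hφ := norm_sq_momentum_phi0 k
  have hg := (norm_sq_iterate_momentumStep t k (momentum phi0 k)).trans hφ
  have hv := norm_sq_velocity k ((momentumStep k)^[t] (momentum phi0 k))
  have hb := (norm_sq_corrector_le k ((momentumStep k)^[t] (momentum phi0 k))).trans_eq hg
  have hh := (norm_sq_iterate_momentumStep t k (corrector k (momentum phi0 k))).trans_le
    ((norm_sq_corrector_le k (momentum phi0 k)).trans_eq hφ)
  rw [hg, mul_one] at hv
  generalize velocity k ((momentumStep k)^[t] (momentum phi0 k)) = p at *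
  generalize corrector k ((momentumStep k)^[t] (momentum phi0 k)) = b at *
  generalize (momentumStep k)^[t] (corrector k (momentum phi0 k)) = h at *
  have hle : Real.cos k ^ 2 / (1 + Real.cos k ^ 2) ≤ 1 := by
    rw [div_le_one (by positivity)]
    linarith
  have hsq {x y : ℝ} (hxy : x ^ 2 + y ^ 2 ≤ 1) : x ≤ 1 ∧ y ≤ 1 :=
    ⟨by nlinarith [sq_nonneg y], by nlinarith [sq_nonneg x]⟩
  have hcomp {p b h : ℂ} (hp : ‖p‖ ≤ 1) (hb : ‖b‖ ≤ 1) (hh : ‖h‖ ≤ 1) :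
      |‖t * p + (b - h)‖ ^ 2 - t ^ 2 * ‖p‖ ^ 2| ≤ 4 * t + 4 := by
    have hr : ‖b - h‖ ≤ 2 := (norm_sub_le b h).trans (by linarith)
    have hp' : ‖(t : ℂ) * p‖ = t * ‖p‖ := by rw [norm_mul, Complex.norm_natCast]
    have := abs_norm_add_sq_sub_le (t * p) (b - h)
    rw [hp', mul_pow] at this
    refine this.trans ?_
    calc ‖b - h‖ * (2 * (t * ‖p‖) + ‖b - h‖) ≤ 2 * (2 * (t * 1) + 2) := by gcongr
      _ = 4 * t + 4 := by ring
  have hp := hsq (hv.trans_le hle)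
  have h1 := hcomp hp.1 (hsq hb).1 (hsq hh).1
  have h2 := hcomp hp.2 (hsq hb).2 (hsq hh).2
  rw [← hv]
  simp only [Prod.fst_add, Prod.snd_add, Prod.fst_sub, Prod.snd_sub, Prod.smul_fst,
    Prod.smul_snd, smul_eq_mul]
  rw [abs_le] at *
  constructor <;> linarith

theorem two_pi_mul_second_moment (t : ℕ) :
    2 * Real.pi * ∑' x : ℤ, (x : ℝ) ^ 2 * Ppure x t =
      ∫ k in (0 : ℝ)..2 * Real.pi, (‖(momentum (position (hadamardStep^[t] phi0)) k).1‖ ^ 2 +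
        ‖(momentum (position (hadamardStep^[t] phi0)) k).2‖ ^ 2) := by
  have hfin := finite_support_component
    (finite_support_position (finite_support_iterate_hadamardStep t))
  have hcont (n : Fin 2) : Continuous fun k =>
      ‖trigSum (fun x => position (hadamardStep^[t] phi0) (x, n)) k‖ ^ 2 :=
    (continuous_trigSum (hfin n)).norm.pow 2
  have hsummable (n : Fin 2) :
      Summable fun x : ℤ => ‖position (hadamardStep^[t] phi0) (x, n)‖ ^ 2 :=
    summable_of_hasFiniteSupport ((hfin n).subset fun x hx h => hx (by simp [h]))
  simp only [momentum]
  rw [intervalIntegral.integral_add ((hcont 0).intervalIntegrable _ _)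
    ((hcont 1).intervalIntegrable _ _), integral_norm_sq_trigSum (hfin 0),
    integral_norm_sq_trigSum (hfin 1), ← mul_add, ← (hsummable 0).tsum_add (hsummable 1)]
  congr 1
  refine tsum_congr fun x => ?_
  simp [Ppure, position, mul_pow, mul_add]

theorem abs_second_moment_sub_le (t : ℕ) :
    |∑' x : ℤ, (x : ℝ) ^ 2 * Ppure x t - (t : ℝ) ^ 2 * (1 - 1 / √2)| ≤ 8 * (t : ℝ) + 8 := by
  have hpi : 0 < 2 * Real.pi := Real.two_pi_pos
  have hfin := finite_support_component
    (finite_support_position (finite_support_iterate_hadamardStep t))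
  have hcont : Continuous fun k => ‖(momentum (position (hadamardStep^[t] phi0)) k).1‖ ^ 2 +
      ‖(momentum (position (hadamardStep^[t] phi0)) k).2‖ ^ 2 :=
    ((continuous_trigSum (hfin 0)).norm.pow 2).add ((continuous_trigSum (hfin 1)).norm.pow 2)
  have hcont' : Continuous fun k : ℝ =>
      (t : ℝ) ^ 2 * (Real.cos k ^ 2 / (1 + Real.cos k ^ 2)) :=
    continuous_const.mul (Continuous.div (by fun_prop) (by fun_prop) fun k => by positivity)
  have h := intervalIntegral.norm_integral_le_of_norm_le_const (a := 0) (b := 2 * Real.pi)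
    fun k _ => (Real.norm_eq_abs _).trans_le (abs_norm_sq_momentum_position_sub_le t k)
  rw [intervalIntegral.integral_sub (hcont.intervalIntegrable _ _)
    (hcont'.intervalIntegrable _ _), ← two_pi_mul_second_moment,
    intervalIntegral.integral_const_mul, integral_cos_sq_div_one_add_cos_sq, mul_left_comm,
    ← mul_sub, Real.norm_eq_abs, abs_mul, sub_zero, abs_of_pos hpi, mul_comm (8 * (t : ℝ) + 8)]
    at h
  exact le_of_mul_le_mul_left h hpi

theorem iterate_hadamardStep_reflect (t : ℕ) (x : ℤ) :
    (hadamardStep^[t] phi0) (x, 1) = I * (-1) ^ t * (hadamardStep^[t] phi0) (-x, 0) := by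
  induction t generalizing x with
  | zero => by_cases hx : x = 0 <;> simp [phi0, hx, div_eq_mul_inv]
  | succ t ih =>
    have hx : -x - 1 = -(x + 1) := by ring
    simp only [Function.iterate_succ_apply', hadamardStep, hx, one_ne_zero, if_false, if_true,
      ih, neg_neg]
    have hs : ((-1 : ℂ) ^ t) ^ 2 = 1 := by rw [← pow_mul, mul_comm, pow_mul]; simp
    linear_combination (hadamardStep^[t] phi0 (x + 1, 0) / (Real.sqrt 2 : ℂ)) *
      (((-1 : ℂ) ^ t) ^ 2 * I_sq - hs)

theorem Ppure_neg (x : ℤ) (t : ℕ) : Ppure (-x) t = Ppure x t := by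
  simp [Ppure, iterate_hadamardStep_reflect, add_comm]

theorem mean_eq_zero (t : ℕ) : ∑' x : ℤ, (x : ℝ) * Ppure x t = 0 := by
  have h := (Equiv.neg ℤ).tsum_eq fun x : ℤ => (x : ℝ) * Ppure x t
  simp only [Equiv.neg_apply, Ppure_neg, Int.cast_neg, neg_mul, tsum_neg] at h
  linarith

/-- Long-term variance of the pure symmetric Hadamard walk:
`Var(Q_t)/t² → 1 - 1/√2` as `t → ∞`. -/
theorem pure_walk_variance_limit :
    Tendsto (fun t : ℕ => pureVar t / (t : ℝ) ^ 2) atTop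
      (nhds (1 - 1 / Real.sqrt 2)) := by
  rw [tendsto_iff_dist_tendsto_zero]
  have hlim : Tendsto (fun t : ℕ => 16 / (t : ℝ)) atTop (nhds 0) :=
    tendsto_const_div_atTop_nhds_zero_nat 16
  refine squeeze_zero' (Eventually.of_forall fun _ => dist_nonneg) ?_ hlim
  filter_upwards [eventually_ge_atTop 1] with t ht
  have ht' : (1 : ℝ) ≤ t := by exact_mod_cast ht
  have hpos : (0 : ℝ) < t := by linarith
  have h := abs_second_moment_sub_le t
  have hdiff : pureVar t / (t : ℝ) ^ 2 - (1 - 1 / √2) =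
      (∑' x : ℤ, (x : ℝ) ^ 2 * Ppure x t - (t : ℝ) ^ 2 * (1 - 1 / √2)) / (t : ℝ) ^ 2 := by
    rw [pureVar, mean_eq_zero]
    field_simp
    ring
  rw [Real.dist_eq, hdiff, abs_div, abs_of_pos (by positivity : (0 : ℝ) < (t : ℝ) ^ 2),
    div_le_div_iff₀ (by positivity) hpos]
  nlinarith

end
end

section
/- Let U(k) be the Fourier-transformed one-step evolution matrix of the Hadamard walk. For every real k and every odd positive integer t, U(k)^t equals the 2×2 matrix with entries (1,1): −e^{−iω_k t} + 2A_k·cos(ω_k t); (1,2): 2·conj(C_k)·cos(ω_k t); (2,1): 2C_k·cos(ω_k t); (2,2): e^{iω_k t} − 2A_k·cos(ω_k t). -/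
noncomputable section

open Complex Filter

/-- The Fourier-transformed one-step evolution matrix of the Hadamard walk. -/
def Uk (k : ℝ) : Matrix (Fin 2) (Fin 2) ℂ :=
  !![Complex.exp (Complex.I * k) / (Real.sqrt 2 : ℂ),
      Complex.exp (Complex.I * k) / (Real.sqrt 2 : ℂ);
     Complex.exp (-(Complex.I * k)) / (Real.sqrt 2 : ℂ),
      -Complex.exp (-(Complex.I * k)) / (Real.sqrt 2 : ℂ)]

/-- `ω_k = arcsin(sin k / √2)`. -/
def omegaK (k : ℝ) : ℝ := Real.arcsin (Real.sin k / Real.sqrt 2)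

/-- `A_k = 1/2 + cos k / (2√(1 + cos²k))`. -/
def Ak (k : ℝ) : ℝ := 1 / 2 + Real.cos k / (2 * Real.sqrt (1 + Real.cos k ^ 2))

/-- `C_k = e^{-ik} / (2√(1 + cos²k))`. -/
def Ck (k : ℝ) : ℂ :=
  Complex.exp (-(Complex.I * k)) / ((2 * Real.sqrt (1 + Real.cos k ^ 2) : ℝ) : ℂ)

/-- Powers of a combination of complementary idempotents. -/
theorem IsIdempotentElem.smul_add_smul_one_sub_pow {R S : Type*} [CommRing R] [Ring S]
    [Algebra R S] {P : S} (hP : IsIdempotentElem P) (a b : R) (n : ℕ) :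
    (a • P + b • (1 - P)) ^ n = a ^ n • P + b ^ n • (1 - P) := by
  induction n with
  | zero => simp
  | succ n ih =>
    rw [pow_succ, ih]
    simp only [add_mul, mul_add, smul_mul_smul_comm, hP.eq, hP.one_sub.eq,
      hP.mul_one_sub_self, hP.one_sub_mul_self, smul_zero, add_zero, zero_add, pow_succ]

theorem Matrix.fin_two_congr {R : Type*} {a b c d a' b' c' d' : R} (ha : a = a') (hb : b = b')
    (hc : c = c') (hd : d = d') : !![a, b; c, d] = !![a', b'; c', d'] := by
  rw [ha, hb, hc, hd]

theorem sin_omegaK (k : ℝ) : Real.sin (omegaK k) = Real.sin k / Real.sqrt 2 := by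
  have h : |Real.sin k / Real.sqrt 2| ≤ 1 := by
    rw [← sq_le_one_iff_abs_le_one, div_pow, Real.sq_sqrt zero_le_two]
    linarith [Real.sin_sq_le_one k]
  exact Real.sin_arcsin (abs_le.mp h).1 (abs_le.mp h).2

theorem cos_omegaK (k : ℝ) :
    Real.cos (omegaK k) = Real.sqrt (1 + Real.cos k ^ 2) / Real.sqrt 2 := by
  rw [omegaK, Real.cos_arcsin, ← Real.sqrt_div' _ zero_le_two, div_pow,
    Real.sq_sqrt zero_le_two, Real.sin_sq]
  congr 1
  ring

theorem conj_Ck (k : ℝ) : (starRingEnd ℂ) (Ck k) =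
    Complex.exp (Complex.I * k) / ((2 * Real.sqrt (1 + Real.cos k ^ 2) : ℝ) : ℂ) := by
  rw [Ck, map_div₀, Complex.conj_ofReal, ← Complex.exp_conj]
  simp

theorem Ck_mul_conj (k : ℝ) : Ck k * (starRingEnd ℂ) (Ck k) = (Ak k : ℂ) * (1 - Ak k) := by
  have h : 0 < 1 + Real.cos k ^ 2 := by positivity
  have hA : Ak k * (1 - Ak k) = 1 / (2 * Real.sqrt (1 + Real.cos k ^ 2)) ^ 2 := by
    have hs := Real.sq_sqrt h.le
    have hs0 := (Real.sqrt_pos.mpr h).ne'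
    rw [Ak]
    generalize Real.sqrt (1 + Real.cos k ^ 2) = s at *
    field_simp
    linear_combination hs
  rw [conj_Ck, Ck, div_mul_div_comm, ← Complex.exp_add, neg_add_cancel, Complex.exp_zero]
  have := congrArg (fun x : ℝ => (x : ℂ)) hA
  push_cast at this ⊢
  rw [this, ← sq]

/-- The spectral projection of `U(k)` for the eigenvalue `e^{iω_k}`. -/
def ukProj (k : ℝ) : Matrix (Fin 2) (Fin 2) ℂ :=
  !![(Ak k : ℂ), (starRingEnd ℂ) (Ck k); Ck k, 1 - (Ak k : ℂ)]

theorem isIdempotentElem_ukProj (k : ℝ) : IsIdempotentElem (ukProj k) := by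
  have h := Ck_mul_conj k
  rw [IsIdempotentElem, ukProj, Matrix.mul_fin_two]
  apply Matrix.fin_two_congr
  · linear_combination h
  · ring
  · ring
  · linear_combination h

theorem exp_I_mul_add_exp_neg (x : ℝ) :
    Complex.exp (Complex.I * x) + Complex.exp (-(Complex.I * x)) = 2 * (Real.cos x : ℂ) := by
  rw [Complex.ofReal_cos, Complex.two_cos, neg_mul, mul_comm]

theorem exp_I_mul_sub_exp_neg (x : ℝ) :
    Complex.exp (Complex.I * x) - Complex.exp (-(Complex.I * x)) =
      2 * Complex.I * (Real.sin x : ℂ) := by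
  rw [mul_comm, ← neg_mul, Complex.exp_mul_I, Complex.exp_mul_I, Complex.cos_neg,
    Complex.sin_neg, Complex.ofReal_sin]
  ring

/-- Entries of a combination of the spectral projections of `U(k)`. -/
theorem smul_ukProj_add (k : ℝ) (a b : ℂ) :
    a • ukProj k + b • (1 - ukProj k) =
      !![b + (Ak k : ℂ) * (a - b), (starRingEnd ℂ) (Ck k) * (a - b);
         Ck k * (a - b), a - (Ak k : ℂ) * (a - b)] := by
  ext i j
  fin_cases i <;> fin_cases j <;> simp [ukProj] <;> ring

theorem Uk_eq_smul_ukProj (k : ℝ) :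
    Uk k = Complex.exp (Complex.I * omegaK k) • ukProj k +
      (-Complex.exp (-(Complex.I * omegaK k))) • (1 - ukProj k) := by
  have hs0 : Real.sqrt (1 + Real.cos k ^ 2) ≠ 0 := by positivity
  have hs : (Real.sqrt (1 + Real.cos k ^ 2) : ℂ) ≠ 0 := by exact_mod_cast hs0
  have hadd := exp_I_mul_add_exp_neg (omegaK k)
  have hsub := exp_I_mul_sub_exp_neg (omegaK k)
  have hkadd := exp_I_mul_add_exp_neg k
  have hksub := exp_I_mul_sub_exp_neg k
  have hA : 2 * (Ak k : ℂ) =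
      1 + (Real.cos k : ℂ) / (Real.sqrt (1 + Real.cos k ^ 2) : ℂ) := by
    have h : 2 * Ak k = 1 + Real.cos k / Real.sqrt (1 + Real.cos k ^ 2) := by
      rw [Ak]
      field_simp
    exact_mod_cast congrArg (fun x : ℝ => (x : ℂ)) h
  have hAcos : 2 * (Ak k : ℂ) * (Real.cos (omegaK k) : ℂ) =
      (Real.cos (omegaK k) : ℂ) + (Real.cos k : ℂ) / (Real.sqrt 2 : ℂ) := by
    rw [hA, cos_omegaK, Complex.ofReal_div]
    field_simp
  have hsin : (Real.sin (omegaK k) : ℂ) = (Real.sin k : ℂ) / (Real.sqrt 2 : ℂ) := by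
    rw [sin_omegaK, Complex.ofReal_div]
  have hcos : (Real.cos (omegaK k) : ℂ) =
      (Real.sqrt (1 + Real.cos k ^ 2) : ℂ) / (Real.sqrt 2 : ℂ) := by
    rw [cos_omegaK, Complex.ofReal_div]
  rw [smul_ukProj_add, sub_neg_eq_add, hadd, conj_Ck, Ck, Uk]
  apply Matrix.fin_two_congr
  · linear_combination 1 / (2 * (Real.sqrt 2 : ℂ)) * (hkadd + hksub) - (hsub - hadd) / 2 - hAcos
      - Complex.I * hsin
  · rw [hcos, Complex.ofReal_mul, Complex.ofReal_ofNat]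
    field_simp
  · rw [hcos, Complex.ofReal_mul, Complex.ofReal_ofNat]
    field_simp
  · linear_combination -1 / (2 * (Real.sqrt 2 : ℂ)) * (hkadd - hksub) - (hadd + hsub) / 2
      + hAcos - Complex.I * hsin

/-- Closed form of `U(k)^t` for odd positive `t`. -/
theorem Uk_pow_odd (k : ℝ) (t : ℕ) (ht : Odd t) (ht0 : 0 < t) :
    Uk k ^ t =
      !![-Complex.exp (-(Complex.I * (omegaK k) * t))
            + 2 * ((Ak k : ℝ) : ℂ) * ((Real.cos (omegaK k * t) : ℝ) : ℂ),
          2 * (starRingEnd ℂ) (Ck k) * ((Real.cos (omegaK k * t) : ℝ) : ℂ);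
         2 * Ck k * ((Real.cos (omegaK k * t) : ℝ) : ℂ),
          Complex.exp (Complex.I * (omegaK k) * t)
            - 2 * ((Ak k : ℝ) : ℂ) * ((Real.cos (omegaK k * t) : ℝ) : ℂ)] := by
  have h := exp_I_mul_add_exp_neg (omegaK k * t)
  rw [Complex.ofReal_mul, Complex.ofReal_natCast, ← mul_assoc] at h
  rw [Uk_eq_smul_ukProj, (isIdempotentElem_ukProj k).smul_add_smul_one_sub_pow, smul_ukProj_add,
    ht.neg_pow, ← Complex.exp_nat_mul, ← Complex.exp_nat_mul, mul_neg, mul_comm (t : ℂ),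
    sub_neg_eq_add, h]
  apply Matrix.fin_two_congr <;> ring

end
end
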